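/- arXiv:2504.04876 — 3 statements merged into one kernel-verified Lean document; each statement's English description precedes it below -/
import Mathlib

section
/- An abelian group G is co-Bassian if and only if for each prime p the p-primary component T_p of the torsion subgroup T of G has finite p-rank (i.e., the subgroup T_p[p] = {x ∈ T_p : p·x = 0} is finite), and the quotient G/T is a divisible group of finite torsion-free rank (i.e., finite rank as an abelian group). -/
open scoped TensorProduct DirectSum

/-- An abelian group is divisible if every element is divisible by every positive integer. -/
def IsDivisibleGrp (G : Type*) [AddCommGroup G] : Prop :=
  ∀ n : ℕ, 0 < n → ∀ d : G, ∃ x : G, n • x = d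

/-- An abelian group `G` is co-Bassian if for every subgroup `N`, every injective
homomorphism `G → G/N` is surjective. -/
def IsCoBassian (G : Type*) [AddCommGroup G] : Prop :=
  ∀ N : AddSubgroup G, ∀ φ : G →+ G ⧸ N, Function.Injective φ → Function.Surjective φ

/-- A subgroup `A` of an abelian group is a direct summand if it has a complement. -/
def IsDirectSummand {G : Type*} [AddCommGroup G] (A : AddSubgroup G) : Prop :=
  ∃ C : AddSubgroup G, A ⊔ C = ⊤ ∧ A ⊓ C = ⊥

/-- An abelian group `G` is generalized co-Bassian if for every subgroup `N` and every
injective homomorphism `φ : G → G/N`, the image of `φ` is a direct summand of `G/N`. -/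
def IsGenCoBassian (G : Type*) [AddCommGroup G] : Prop :=
  ∀ N : AddSubgroup G, ∀ φ : G →+ G ⧸ N, Function.Injective φ → IsDirectSummand φ.range

section GeneralLemmas

/-- A co-Bassian group has the co-Bassian property relative to any surjection. -/
theorem IsCoBassian.surj {G H : Type*} [AddCommGroup G] [AddCommGroup H] (hG : IsCoBassian G)
    (s : G →+ H) (hs : Function.Surjective s) (φ : G →+ H) (hφ : Function.Injective φ) :
    Function.Surjective φ := by
  let e := QuotientAddGroup.quotientKerEquivOfSurjective s hs
  have h := hG s.ker ((e.symm : H →+ G ⧸ s.ker).comp φ) (by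
    intro a b hab
    exact hφ (e.symm.injective hab))
  intro y
  obtain ⟨x, hx⟩ := h (e.symm y)
  exact ⟨x, e.symm.injective hx⟩

theorem IsCoBassian.shift {F G E : Type*} [AddCommGroup F] [AddCommGroup G] [AddCommGroup E]
    (hG : IsCoBassian G) (f : F →+ G) (q ψ : G →+ E)
    (h1 : ∀ g, ∃ a, q (f a) = q g) (h2 : ∀ g, ∃ g', ψ g = q g')
    (h3 : ∀ a, ψ (f a) = 0 → f a = 0) : ∀ g, ∃ g', q g = ψ g' := by
  let s : G →+ q.range × (G ⧸ f.range) := q.rangeRestrict.prod (QuotientAddGroup.mk' f.range)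
  let ψ' : G →+ q.range := ψ.codRestrict q.range (by
    intro g
    obtain ⟨g', h⟩ := h2 g
    exact ⟨g', h.symm⟩)
  let φ : G →+ q.range × (G ⧸ f.range) := ψ'.prod (QuotientAddGroup.mk' f.range)
  have hs : Function.Surjective s := by
    rintro ⟨⟨_, g, rfl⟩, y⟩
    obtain ⟨g2, rfl⟩ := QuotientAddGroup.mk_surjective y
    obtain ⟨a, ha⟩ := h1 (g - g2)
    refine ⟨g2 + f a, ?_⟩
    ext
    · simp [s, ha]
    · simp [s]
  have hφ : Function.Injective φ := by
    rw [injective_iff_map_eq_zero]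
    intro g hg
    have h4 : ψ g = 0 := congrArg (fun z => (z.1 : E)) hg
    have h5 : (QuotientAddGroup.mk' f.range) g = 0 := congrArg (fun z => z.2) hg
    obtain ⟨a, rfl⟩ := (QuotientAddGroup.eq_zero_iff g).1 h5
    exact h3 a h4
  intro g
  obtain ⟨g', hg'⟩ := hG.surj s hs φ hφ (⟨q g, g, rfl⟩, 0)
  exact ⟨g', (congrArg (fun z => (z.1 : E)) hg').symm⟩

theorem IsDivisibleGrp.baer {E : Type*} [AddCommGroup E] (hE : IsDivisibleGrp E) :
    Module.Baer ℤ E := by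
  let _ : DivisibleBy E ℕ := divisibleByOfSMulRightSurj E ℕ (by
    intro n hn d
    exact hE n (Nat.pos_of_ne_zero hn) d)
  let _ : DivisibleBy E ℤ := AddGroup.divisibleByIntOfDivisibleByNat E
  exact Module.Baer.of_divisible E

theorem IsDivisibleGrp.extend {F B E : Type*} [AddCommGroup F] [AddCommGroup B] [AddCommGroup E]
    (hE : IsDivisibleGrp E) (f : F →+ B) (g : F →+ E) (h : ∀ x, f x = 0 → g x = 0) :
    ∃ r : B →+ E, ∀ x, r (f x) = g x := by
  obtain ⟨r, hr⟩ := hE.baer.extension_property_addMonoidHom (QuotientAddGroup.kerLift f)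
    (QuotientAddGroup.kerLift_injective f) (QuotientAddGroup.lift f.ker g h)
  exact ⟨r, fun x => DFunLike.congr_fun hr (QuotientAddGroup.mk x)⟩

theorem IsDivisibleGrp.of_surj {A B : Type*} [AddCommGroup A] [AddCommGroup B]
    (hA : IsDivisibleGrp A) (f : A →+ B) (hf : Function.Surjective f) : IsDivisibleGrp B := by
  intro n hn d
  obtain ⟨a, rfl⟩ := hf d
  obtain ⟨x, rfl⟩ := hA n hn a
  exact ⟨f x, by simp⟩

theorem IsDivisibleGrp.finsupp {Q : Type*} [AddCommGroup Q] (hQ : IsDivisibleGrp Q) :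
    IsDivisibleGrp (ℕ →₀ Q) := by
  intro n hn d
  induction d using Finsupp.induction_linear with
  | zero => exact ⟨0, by simp⟩
  | add f g hf hg =>
    obtain ⟨x, rfl⟩ := hf
    obtain ⟨y, rfl⟩ := hg
    exact ⟨x + y, by simp⟩
  | single a b =>
    obtain ⟨x, rfl⟩ := hQ n hn b
    exact ⟨Finsupp.single a x, by simp⟩

theorem exists_divisible_embedding.{u} (G : Type u) [AddCommGroup G] :
    ∃ (E : Type u) (_ : AddCommGroup E) (ψ : G →+ E), IsDivisibleGrp E ∧ Function.Injective ψ := by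
  refine ⟨CharacterModule G → AddCircle (1 : ℚ), inferInstance,
    ⟨⟨fun a i ↦ i a, by ext; simp⟩, by intros; ext; simp⟩, ?_, ?_⟩
  · intro n hn d
    have : ∀ a : AddCircle (1 : ℚ), ∃ x, n • x = a := by
      intro a
      obtain ⟨r, rfl⟩ := QuotientAddGroup.mk_surjective a
      refine ⟨((r / n : ℚ) : AddCircle (1 : ℚ)), ?_⟩
      have : n • (r / n : ℚ) = r := by simp; field_simp
      conv_rhs => rw [← this]
      rfl
    choose x hx using fun c => this (d c)
    exact ⟨x, by ext c; simp [hx]⟩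
  · rw [injective_iff_map_eq_zero]
    intro a h0
    exact CharacterModule.eq_zero_of_character_apply (fun c => congr_fun h0 c)

theorem exists_prufer (p : ℕ) [Fact p.Prime] :
    ∃ (Q : Type) (_ : AddCommGroup Q) (c : ℕ → Q), IsDivisibleGrp Q ∧
      (∀ (b : ℕ) (k : ℤ), k • c b = 0 ↔ (p : ℤ) ^ b ∣ k) ∧
      (∀ (b : ℕ) (x : Q), (p : ℤ) ^ b • x = 0 → ∃ k : ℤ, x = k • c b) ∧
      (∀ x : Q, ∃ b : ℕ, (p : ℤ) ^ b • x = 0) := by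
  have hp0 : (p : ℚ_[p]) ≠ 0 := by exact_mod_cast (Fact.out : p.Prime).ne_zero
  let S : AddSubgroup ℚ_[p] := (PadicInt.subring p).toAddSubgroup
  have hS : ∀ x : ℚ_[p], x ∈ S ↔ ‖x‖ ≤ 1 := fun x => Iff.rfl
  refine ⟨ℚ_[p] ⧸ S, inferInstance, fun b => QuotientAddGroup.mk ((p : ℚ_[p]) ^ b)⁻¹, ?_, ?_, ?_, ?_⟩
  · refine IsDivisibleGrp.of_surj ?_ (QuotientAddGroup.mk' S) (QuotientAddGroup.mk'_surjective S)
    intro n hn d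
    have : (n : ℚ_[p]) ≠ 0 := by exact_mod_cast hn.ne'
    exact ⟨d / n, by simp; field_simp⟩
  · intro b k
    rw [← QuotientAddGroup.mk_zsmul, QuotientAddGroup.eq_zero_iff, hS]
    have := Padic.norm_int_le_pow_iff_dvd (p := p) k b
    rw [← Nat.cast_pow, ← this]
    have hp1 : (0 : ℝ) < p := by exact_mod_cast (Fact.out : p.Prime).pos
    simp [norm_mul]
    rw [← one_div, le_div_iff₀ (by positivity)]
  · intro b x hx
    obtain ⟨y, rfl⟩ := QuotientAddGroup.mk_surjective x
    rw [← QuotientAddGroup.mk_zsmul, QuotientAddGroup.eq_zero_iff, hS] at hx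
    let z : ℤ_[p] := ⟨_, hx⟩
    obtain ⟨e, he⟩ := Ideal.mem_span_singleton.mp (PadicInt.appr_spec b z)
    refine ⟨z.appr b, ?_⟩
    rw [← QuotientAddGroup.mk_zsmul, QuotientAddGroup.eq_iff_sub_mem, hS]
    have h2 := congrArg (fun t : ℤ_[p] => (t : ℚ_[p])) he
    have h3 : y - (z.appr b : ℤ) • ((p : ℚ_[p]) ^ b)⁻¹ = e := by
      have h4 : (z : ℚ_[p]) = (p : ℚ_[p]) ^ b * y := by simp [z]
      rw [PadicInt.coe_sub, h4] at h2
      generalize z.appr b = m at h2 ⊢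
      simp at h2 ⊢
      field_simp
      rw [← h2]
      ring
    rw [h3]
    exact e.2
  · intro x
    obtain ⟨y, rfl⟩ := QuotientAddGroup.mk_surjective x
    obtain ⟨b, hb⟩ : ∃ b : ℕ, ‖y‖ ≤ (p : ℝ) ^ b := by
      have hp1 : (1 : ℝ) < p := by exact_mod_cast (Fact.out : p.Prime).one_lt
      obtain ⟨b, hb⟩ := pow_unbounded_of_one_lt ‖y‖ hp1
      exact ⟨b, hb.le⟩
    refine ⟨b, ?_⟩
    rw [← QuotientAddGroup.mk_zsmul, QuotientAddGroup.eq_zero_iff, hS]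
    have hp1 : (0 : ℝ) < p := by exact_mod_cast (Fact.out : p.Prime).pos
    simp
    rw [inv_mul_le_one₀ (by positivity)]
    exact hb

end GeneralLemmas

section Sequences

open Finsupp

theorem exists_indep_seq {G : Type*} [AddCommGroup G] (p : ℕ) (hp : p.Prime) (W : AddSubgroup G)
    (hW : (W : Set G).Finite) (S : ℕ → Set G) (hS : ∀ i, (S i).Infinite)
    (hSp : ∀ i, ∀ y ∈ S i, p • y = 0) :
    ∃ y : ℕ → G, (∀ i, y i ∈ S i) ∧
      ∀ c : ℕ →₀ ℤ, linearCombination ℤ y c ∈ W → ∀ i, (p : ℤ) ∣ c i := by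
  have hex : ∀ (i : ℕ) (H : {H : AddSubgroup G // (H : Set G).Finite}), ∃ y ∈ S i, y ∉ H.1 := by
    intro i H
    obtain ⟨y, hy, hy'⟩ := (hS i).exists_notMem_finite H.2
    exact ⟨y, hy, hy'⟩
  choose f hf1 hf2 using hex
  have hfin : ∀ (i : ℕ) (H : {H : AddSubgroup G // (H : Set G).Finite}),
      ((H.1 ⊔ AddSubgroup.zmultiples (f i H) : AddSubgroup G) : Set G).Finite := by
    intro i H
    rw [AddSubgroup.add_normal]
    refine H.2.add ?_
    have : IsOfFinAddOrder (f i H) := by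
      rw [isOfFinAddOrder_iff_nsmul_eq_zero]
      exact ⟨p, hp.pos, hSp _ _ (hf1 i H)⟩
    exact this.finite_zmultiples
  let H : ℕ → {H : AddSubgroup G // (H : Set G).Finite} := fun n =>
    Nat.rec ⟨W, hW⟩ (fun i H => ⟨_, hfin i H⟩) n
  have hH0 : (H 0).1 = W := rfl
  have hHs : ∀ i, (H (i + 1)).1 = (H i).1 ⊔ AddSubgroup.zmultiples (f i (H i)) := fun i => rfl
  have hmono : Monotone (fun i => (H i).1) := monotone_nat_of_le_succ (fun i => by
    rw [hHs]; exact le_sup_left)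
  refine ⟨fun i => f i (H i), fun i => hf1 _ _, ?_⟩
  intro c hc
  by_contra! hcon
  obtain ⟨i0, hi0⟩ := hcon
  let I := c.support.filter (fun i => ¬ (p : ℤ) ∣ c i)
  have hI : I.Nonempty := ⟨i0, by
    simp only [I, Finset.mem_filter, mem_support_iff]
    refine ⟨?_, hi0⟩
    intro h; rw [h] at hi0; exact hi0 (dvd_zero _)⟩
  let i := I.max' hI
  have hiI : i ∈ I := I.max'_mem hI
  have hi : i ∈ c.support ∧ ¬ (p : ℤ) ∣ c i := by simpa only [I, Finset.mem_filter] using hiI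
  have hrest : ∀ j ∈ c.support.erase i, c j • f j (H j) ∈ (H i).1 := by
    intro j hj
    rw [Finset.mem_erase] at hj
    rcases lt_or_gt_of_ne hj.1 with h | h
    · refine AddSubgroup.zsmul_mem _ (hmono (Nat.succ_le_of_lt h) ?_) _
      show _ ∈ (H (j + 1)).1
      rw [hHs]
      exact (le_sup_right : _ ≤ (H j).1 ⊔ _) (AddSubgroup.mem_zmultiples _)
    · have : (p : ℤ) ∣ c j := by
        by_contra hnd
        have := I.le_max' j (by simp only [I, Finset.mem_filter]; exact ⟨hj.2, hnd⟩)
        exact absurd this (not_le.2 h)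
      obtain ⟨d, hd⟩ := this
      rw [hd, mul_comm, mul_smul, natCast_zsmul, hSp _ _ (hf1 j (H j)), smul_zero]
      exact zero_mem _
  have hci : c i • f i (H i) ∈ (H i).1 := by
    rw [linearCombination_apply, Finsupp.sum, ← Finset.add_sum_erase _ _ hi.1] at hc
    have h1 := hmono (Nat.zero_le i) hc
    exact (AddSubgroup.add_mem_cancel_right _ (AddSubgroup.sum_mem _ hrest)).1 h1
  have hcop : IsCoprime (p : ℤ) (c i) :=
    (Prime.coprime_iff_not_dvd (Nat.prime_iff_prime_int.1 hp)).2 hi.2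
  obtain ⟨a, b, hab⟩ := hcop
  apply hf2 i (H i)
  have : f i (H i) = b • c i • f i (H i) := by
    conv_lhs => rw [← one_smul ℤ (f i (H i)), ← hab, add_smul, mul_smul, mul_smul, natCast_zsmul,
      hSp _ _ (hf1 i (H i)), smul_zero, zero_add]
  rw [this]
  exact AddSubgroup.zsmul_mem _ hci _

theorem dvd_of_indep {G : Type*} [AddCommGroup G] (p : ℕ) (hp : p.Prime) (U : AddSubgroup G)
    (x y : ℕ → G) (d : ℕ → ℕ) (hxy : ∀ i, (p : ℤ) ^ d i • x i = y i)
    (hy : ∀ c : ℕ →₀ ℤ, linearCombination ℤ y c ∈ U → ∀ i, (p : ℤ) ∣ c i)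
    (k : ℕ →₀ ℤ) (hk : linearCombination ℤ x k ∈ U) : ∀ i, (p : ℤ) ^ (d i + 1) ∣ k i := by
  have hp0 : (p : ℤ) ≠ 0 := by exact_mod_cast hp.ne_zero
  have key : ∀ m : ℕ, (∀ i, (p : ℤ) ^ (d i + 1) ∣ (p : ℤ) ^ m * k i) →
      ∀ i, (p : ℤ) ^ (d i + 1) ∣ k i := by
    intro m
    induction m with
    | zero => intro h; simpa using h
    | succ m ih =>
      intro h
      apply ih
      have h1 : ∀ i, (p : ℤ) ^ d i ∣ (p : ℤ) ^ m * k i := by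
        intro i
        have := h i
        rw [pow_succ, pow_succ, mul_right_comm] at this
        exact Int.dvd_of_mul_dvd_mul_right hp0 this
      let c : ℕ →₀ ℤ := Finsupp.onFinset k.support (fun i => (p : ℤ) ^ m * k i / (p : ℤ) ^ d i) (by
        intro i hi
        rw [mem_support_iff]
        rintro h0
        apply hi
        simp [h0])
      have hc : ∀ i, c i * (p : ℤ) ^ d i = (p : ℤ) ^ m * k i := fun i => Int.ediv_mul_cancel (h1 i)
      have hsum : linearCombination ℤ y c = (p : ℤ) ^ m • linearCombination ℤ x k := by
        rw [linearCombination_apply, linearCombination_apply, Finsupp.smul_sum,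
          Finsupp.sum_of_support_subset c (Finsupp.support_onFinset_subset) _ (by simp), Finsupp.sum]
        refine Finset.sum_congr rfl fun i _ => ?_
        rw [← hxy, smul_smul, smul_smul, hc]
      have h2 := hy c (by rw [hsum]; exact AddSubgroup.zsmul_mem _ hk _)
      intro i
      rw [← hc i, pow_succ, mul_comm (c i)]
      exact mul_dvd_mul_left _ (h2 i)
  apply key (k.support.sup d + 1)
  intro i
  by_cases hi : i ∈ k.support
  · exact Dvd.dvd.mul_right (pow_dvd_pow _ (Nat.succ_le_succ (Finset.le_sup (f := d) hi))) _
  · rw [notMem_support_iff.1 hi]; simp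

end Sequences

section Necessity

open Finsupp

theorem lc_single_apply {Q : Type*} [AddCommGroup Q] (v : ℕ → Q) (a : ℕ →₀ ℤ) (j : ℕ) :
    (linearCombination ℤ (fun i => single i (v i)) a) j = a j • v j := by
  induction a using Finsupp.induction_linear with
  | zero => simp
  | add f g hf hg => rw [map_add, Finsupp.add_apply, hf, hg, Finsupp.add_apply, add_smul]
  | single i k =>
    rw [linearCombination_single, Finsupp.smul_apply]
    by_cases h : i = j
    · subst h; simp
    · simp [h]

/-- The shift map on finitely supported sequences. -/
noncomputable def shiftHom (Q : Type*) [AddCommGroup Q] : (ℕ →₀ Q) →+ (ℕ →₀ Q) :=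
  Finsupp.mapDomain.addMonoidHom Nat.succ

theorem shiftHom_injective (Q : Type*) [AddCommGroup Q] : Function.Injective (shiftHom Q) :=
  Finsupp.mapDomain_injective Nat.succ_injective

theorem shiftHom_zero (Q : Type*) [AddCommGroup Q] (a : ℕ →₀ Q) : shiftHom Q a 0 = 0 :=
  Finsupp.mapDomain_of_notMem_range _ _ (by simp)

theorem not_coBassian_of_div {F G Q : Type*} [AddCommGroup F] [AddCommGroup G] [AddCommGroup Q]
    [Nontrivial Q] (hG : IsCoBassian G) (hQ : IsDivisibleGrp Q) (f : F →+ G)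
    (q' ψ' : F →+ (ℕ →₀ Q)) (hq : Function.Surjective q') (hqk : ∀ a, f a = 0 → q' a = 0)
    (hψ : ∀ a, f a = 0 ↔ ψ' a = 0) : False := by
  obtain ⟨q, hq1⟩ := hQ.finsupp.extend f q' hqk
  obtain ⟨ψ, hψ1⟩ := hQ.finsupp.extend f ψ' (fun a => (hψ a).1)
  have hqs : ∀ e, ∃ a, q (f a) = e := by
    intro e
    obtain ⟨a, rfl⟩ := hq e
    exact ⟨a, hq1 a⟩
  have := hG.shift f q ((shiftHom Q).comp ψ) (fun g => hqs _)
    (fun g => by obtain ⟨a, ha⟩ := hqs (((shiftHom Q).comp ψ) g); exact ⟨f a, ha.symm⟩)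
    (by
      intro a ha
      rw [hψ, ← hψ1]
      exact (injective_iff_map_eq_zero _).1 (shiftHom_injective Q) _ ha)
  obtain ⟨t, ht⟩ := exists_ne (0 : Q)
  obtain ⟨a, ha⟩ := hqs (single 0 t)
  obtain ⟨g', hg'⟩ := this (f a)
  rw [ha] at hg'
  have h0 := DFunLike.congr_fun hg' 0
  rw [AddMonoidHom.comp_apply, shiftHom_zero] at h0
  exact ht (by simpa using h0)

theorem coBassian_prank {G : Type*} [AddCommGroup G] (hG : IsCoBassian G) (p : ℕ)
    [hp : Fact p.Prime] : {x : G | p • x = 0}.Finite := by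
  by_contra hinf
  have hp0 := hp.out
  obtain ⟨Q, _, c, hQ, hc1, hc2, hc3⟩ := exists_prufer p
  let V : ℕ → Set G := fun n => {y | p • y = 0 ∧ ∃ g, (p : ℤ) ^ n • g = y}
  have hV0 : (V 0).Infinite := by
    have : V 0 = {x : G | p • x = 0} := by ext; simp [V]
    rw [this]; exact hinf
  have : Nontrivial Q := by
    refine ⟨c 1, 0, ?_⟩
    intro h
    have := (hc1 1 1).1 (by rw [h]; simp)
    rw [pow_one] at this
    have := Int.eq_one_of_dvd_one (by positivity) this
    exact hp0.one_lt.ne' (by exact_mod_cast this)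
  by_cases hall : ∀ n, (V n).Infinite
  · obtain ⟨y, hy1, hy2⟩ := exists_indep_seq p hp0 (⊥ : AddSubgroup G) (by simp) V hall
      (fun i y hy => hy.1)
    choose x hx using fun i => (hy1 i).2
    have hdvd := dvd_of_indep p hp0 ⊥ x y id hx hy2
    have hx0 : ∀ i, (p : ℤ) ^ (i + 1) • x i = 0 := by
      intro i
      rw [pow_succ', mul_smul, hx, natCast_zsmul, (hy1 i).1]
    have hfx : ∀ a, linearCombination ℤ x a = 0 ↔ ∀ i, (p : ℤ) ^ (i + 1) ∣ a i := by
      intro a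
      constructor
      · intro h
        exact hdvd a (by rw [h]; exact zero_mem _)
      · intro h
        rw [linearCombination_apply, Finsupp.sum]
        refine Finset.sum_eq_zero fun i _ => ?_
        obtain ⟨t, ht⟩ := h i
        rw [ht, mul_comm, mul_smul, hx0, smul_zero]
    refine not_coBassian_of_div hG hQ (linearCombination ℤ x).toAddMonoidHom
      (linearCombination ℤ (fun i => single i.unpair.1 (c i.unpair.2))).toAddMonoidHom
      (linearCombination ℤ (fun i => single i (c (i + 1)))).toAddMonoidHom ?_ ?_ ?_
    · intro e
      simp only [LinearMap.toAddMonoidHom_coe]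
      induction e using Finsupp.induction_linear with
      | zero => exact ⟨0, map_zero _⟩
      | add e1 e2 h1 h2 =>
        obtain ⟨a, rfl⟩ := h1
        obtain ⟨b, rfl⟩ := h2
        exact ⟨a + b, map_add _ _ _⟩
      | single j t =>
        obtain ⟨b, hb⟩ := hc3 t
        obtain ⟨k, rfl⟩ := hc2 b t hb
        exact ⟨single (Nat.pair j b) k, by simp⟩
    · intro a ha
      simp only [LinearMap.toAddMonoidHom_coe] at ha ⊢
      rw [hfx] at ha
      rw [linearCombination_apply, Finsupp.sum]
      refine Finset.sum_eq_zero fun i _ => ?_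
      rw [smul_single, (hc1 _ _).2, single_zero]
      exact (pow_dvd_pow _ ((Nat.unpair_right_le i).trans (Nat.le_succ i))).trans (ha i)
    · intro a
      simp only [LinearMap.toAddMonoidHom_coe]
      rw [hfx, Finsupp.ext_iff]
      refine forall_congr' fun i => ?_
      rw [lc_single_apply (fun i => c (i + 1)), Finsupp.zero_apply, hc1]
  · obtain ⟨n, hn, hn1⟩ : ∃ n, (V n).Infinite ∧ ¬ (V (n + 1)).Infinite := by
      by_contra! hcon
      exact hall (fun n => Nat.rec hV0 hcon n)
    let m := n + 1
    let U : AddSubgroup G := (zsmulAddGroupHom ((p : ℤ) ^ m) : G →+ G).range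
    let W : AddSubgroup G := U ⊓ (zsmulAddGroupHom (p : ℤ) : G →+ G).ker
    have hWf : (W : Set G).Finite := by
      refine (Set.not_infinite.1 hn1).subset ?_
      rintro w ⟨⟨g, hg⟩, hw⟩
      refine ⟨?_, g, hg⟩
      rw [← natCast_zsmul]; exact hw
    obtain ⟨y, hy1, hy2⟩ := exists_indep_seq p hp0 W hWf (fun _ => V n) (fun _ => hn)
      (fun i y hy => hy.1)
    choose x hx using fun i => (hy1 i).2
    have hdvd := dvd_of_indep p hp0 U x y (fun _ => n) hx (by
      intro k hk
      refine hy2 k ⟨hk, ?_⟩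
      show (p : ℤ) • (linearCombination ℤ y k) = 0
      rw [linearCombination_apply, Finsupp.smul_sum, Finsupp.sum]
      refine Finset.sum_eq_zero fun i _ => ?_
      rw [smul_comm, natCast_zsmul, (hy1 i).1, smul_zero])
    have hx0 : ∀ i, (p : ℤ) ^ m • x i = 0 := by
      intro i
      rw [pow_succ', mul_smul, hx, natCast_zsmul, (hy1 i).1]
    let g0 : (ℕ →₀ ℤ) →+ (ℕ →₀ Q) := (linearCombination ℤ (fun i => single i (c m))).toAddMonoidHom
    have hg0 : ∀ a i, g0 a i = a i • c m := fun a i => lc_single_apply (fun _ => c m) a i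
    have hg0k : ∀ a, g0 a = 0 ↔ ∀ i, (p : ℤ) ^ m ∣ a i := by
      intro a
      rw [Finsupp.ext_iff]
      refine forall_congr' fun i => ?_
      rw [hg0, Finsupp.zero_apply, hc1]
    have hg0s : ∀ e : ℕ →₀ Q, (p : ℤ) ^ m • e = 0 → ∃ a, g0 a = e := by
      intro e he
      have : ∀ t : Q, ∃ k : ℤ, ((p : ℤ) ^ m • t = 0 → t = k • c m) ∧ (t = 0 → k = 0) := by
        intro t
        by_cases ht0 : t = 0
        · exact ⟨0, by simp [ht0], fun _ => rfl⟩
        by_cases ht : (p : ℤ) ^ m • t = 0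
        · obtain ⟨k, hk⟩ := hc2 m t ht
          exact ⟨k, fun _ => hk, fun h => absurd h ht0⟩
        · exact ⟨0, fun h => absurd h ht, fun _ => rfl⟩
      choose κ hκ1 hκ2 using this
      refine ⟨e.mapRange κ (hκ2 0 rfl), ?_⟩
      ext i
      rw [hg0, mapRange_apply]
      exact (hκ1 (e i) (by
        have := DFunLike.congr_fun he i
        simpa using this)).symm
    let f : (ℕ →₀ ℤ) →+ G := (linearCombination ℤ x).toAddMonoidHom
    obtain ⟨r, hr⟩ := hQ.finsupp.extend ((QuotientAddGroup.mk' U).comp f) g0 (by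
      intro a ha
      rw [hg0k]
      exact hdvd a ((QuotientAddGroup.eq_zero_iff _).1 ha))
    let q : G →+ (ℕ →₀ Q) := r.comp (QuotientAddGroup.mk' U)
    have hqf : ∀ a, q (f a) = g0 a := hr
    have hqm : ∀ g, (p : ℤ) ^ m • q g = 0 := by
      intro g
      rw [← map_zsmul]
      have : (QuotientAddGroup.mk' U) ((p : ℤ) ^ m • g) = 0 :=
        (QuotientAddGroup.eq_zero_iff _).2 ⟨g, rfl⟩
      show r _ = 0
      rw [this, map_zero]
    have hsh := hG.shift f q ((shiftHom Q).comp q)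
      (fun g => by
        obtain ⟨a, ha⟩ := hg0s _ (hqm g)
        exact ⟨a, by rw [hqf, ha]⟩)
      (fun g => by
        obtain ⟨a, ha⟩ := hg0s (((shiftHom Q).comp q) g) (by
          rw [AddMonoidHom.comp_apply, ← map_zsmul, hqm, map_zero])
        exact ⟨f a, by rw [hqf, ha]⟩)
      (fun a ha => by
        have h1 : q (f a) = 0 := (injective_iff_map_eq_zero _).1 (shiftHom_injective Q) _ ha
        rw [hqf, hg0k] at h1
        show linearCombination ℤ x a = 0
        rw [linearCombination_apply, Finsupp.sum]
        refine Finset.sum_eq_zero fun i _ => ?_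
        obtain ⟨t, ht⟩ := h1 i
        rw [ht, mul_comm, mul_smul, hx0, smul_zero])
    obtain ⟨g', hg'⟩ := hsh (f (single 0 1))
    have h0 := DFunLike.congr_fun hg' 0
    rw [AddMonoidHom.comp_apply (shiftHom Q) q, shiftHom_zero, hqf, hg0, hc1, single_eq_same] at h0
    have := Int.eq_one_of_dvd_one (by positivity) ((dvd_pow_self (p : ℤ) (Nat.succ_ne_zero n)).trans h0)
    exact hp0.one_lt.ne' (by exact_mod_cast this)

theorem coBassian_no_indep {G : Type*} [AddCommGroup G] (hG : IsCoBassian G) (x : ℕ → G)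
    (hx : LinearIndependent ℤ x) : False := by
  obtain ⟨e, he⟩ := exists_surjective_nat (ℕ →₀ ℚ)
  refine not_coBassian_of_div hG (Q := ℚ) ?_ (linearCombination ℤ x).toAddMonoidHom
    (linearCombination ℤ e).toAddMonoidHom
    (linearCombination ℤ (fun i => single i (1 : ℚ))).toAddMonoidHom ?_ ?_ ?_
  · intro n hn d
    exact ⟨d / n, by simp; field_simp⟩
  · intro t
    obtain ⟨i, rfl⟩ := he t
    exact ⟨single i 1, by simp⟩
  · intro a ha
    have : a = 0 := (injective_iff_map_eq_zero (linearCombination ℤ x)).1 hx a ha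
    rw [this, map_zero]
  · intro a
    constructor
    · intro ha
      have : a = 0 := (injective_iff_map_eq_zero (linearCombination ℤ x)).1 hx a ha
      rw [this, map_zero]
    · intro ha
      have : a = 0 := by
        ext i
        have h1 := lc_single_apply (fun _ => (1 : ℚ)) a i
        have h2 : (linearCombination ℤ (fun i => single i (1 : ℚ))) a = 0 := ha
        rw [h2] at h1
        simpa using h1.symm
      rw [this, map_zero]

theorem coBassian_finrank {G : Type*} [AddCommGroup G] (hG : IsCoBassian G) :
    FiniteDimensional ℚ (ℚ ⊗[ℤ] (G ⧸ AddCommGroup.torsion G)) := by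
  by_contra hinf
  rw [FiniteDimensional, ← Module.rank_lt_aleph0_iff, not_lt] at hinf
  have h1 : Module.rank ℚ (ℚ ⊗[ℤ] (G ⧸ AddCommGroup.torsion G)) =
      Module.rank ℤ (G ⧸ AddCommGroup.torsion G) := by
    rw [IsLocalization.rank_eq ℚ (nonZeroDivisors ℤ) le_rfl]
    have key := IsLocalizedModule.rank_eq (nonZeroDivisors ℤ) le_rfl
      (TensorProduct.mk ℤ ℚ (G ⧸ AddCommGroup.torsion G) 1)
    convert key using 2
    exact Subsingleton.elim _ _
  rw [h1] at hinf
  obtain ⟨s, hs, hs'⟩ := exists_set_linearIndependent_of_isDomain ℤ (G ⧸ AddCommGroup.torsion G)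
  have : Infinite s := Cardinal.infinite_iff.2 (by rw [hs]; exact hinf)
  let i := Infinite.natEmbedding s
  have hli : LinearIndependent ℤ (fun n => (i n : G ⧸ AddCommGroup.torsion G)) :=
    hs'.comp i i.injective
  choose x hx using fun n => QuotientAddGroup.mk'_surjective _ (i n : G ⧸ AddCommGroup.torsion G)
  refine coBassian_no_indep hG x ?_
  refine LinearIndependent.of_comp
    (QuotientAddGroup.mk' (AddCommGroup.torsion G)).toIntLinearMap ?_
  convert hli using 1
  ext n
  exact hx n

end Necessity

section Splitting

theorem IsDivisibleGrp.of_primes {A : Type*} [AddCommGroup A]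
    (h : ∀ p : ℕ, p.Prime → ∀ d : A, ∃ x : A, p • x = d) : IsDivisibleGrp A := by
  intro n
  induction n using Nat.recOnMul with
  | zero => intro h; exact absurd h (lt_irrefl 0)
  | one => intro _ d; exact ⟨d, one_smul _ _⟩
  | prime p hp => intro _; exact h p hp
  | mul a b ha hb =>
    intro hab d
    obtain ⟨x, rfl⟩ := ha (Nat.pos_of_mul_pos_right hab) d
    obtain ⟨y, rfl⟩ := hb (Nat.pos_of_mul_pos_left hab) x
    exact ⟨y, mul_smul _ _ _⟩

theorem exists_retraction {G : Type*} [AddCommGroup G] (n : ℕ) (P D : AddSubgroup G)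
    (hP : ∀ g, n • g ∈ P → g ∈ P) (hD : IsDivisibleGrp D) (hDP : D ≤ P)
    (hn : ∀ x ∈ P, n • x ∈ D) : ∃ r : G →+ G, (∀ g, r g ∈ P) ∧ ∀ x ∈ P, r x = x := by
  obtain ⟨E, _, ψ, hE, hψ⟩ := exists_divisible_embedding G
  let P' := P.map ψ
  obtain ⟨ρ, hρ⟩ := hD.extend (ψ.comp D.subtype) (AddMonoidHom.id D) (by
    intro x hx
    exact Subtype.ext ((injective_iff_map_eq_zero ψ).1 hψ _ hx))
  let τ : E →+ E := AddMonoidHom.id E - (ψ.comp D.subtype).comp ρ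
  have hτ : ∀ e, τ e = e - ψ (ρ e) := fun e => rfl
  let μ : E ⧸ P' →+ E := QuotientAddGroup.lift P' (τ.comp (nsmulAddMonoidHom n)) (by
    rintro _ ⟨x, hx, rfl⟩
    show τ (n • ψ x) = 0
    rw [← map_nsmul, hτ]
    have := hρ ⟨n • x, hn x hx⟩
    have h2 : ρ (ψ (n • x)) = ⟨n • x, hn x hx⟩ := this
    rw [h2, sub_self])
  have hμ : ∀ z, QuotientAddGroup.mk' P' (μ z) = n • z := by
    intro z
    obtain ⟨e, rfl⟩ := QuotientAddGroup.mk'_surjective P' z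
    have : μ (QuotientAddGroup.mk' P' e) = n • e - ψ (ρ (n • e)) := rfl
    rw [this, map_sub, map_nsmul, sub_eq_self]
    exact (QuotientAddGroup.eq_zero_iff _).2 ⟨_, hDP (ρ (n • e)).2, rfl⟩
  let ψb : G ⧸ P →+ E ⧸ P' := QuotientAddGroup.map P P' ψ (AddSubgroup.le_comap_map ψ P)
  have hE' : IsDivisibleGrp (E ⧸ P') :=
    hE.of_surj (QuotientAddGroup.mk' P') (QuotientAddGroup.mk'_surjective P')
  obtain ⟨θ, hθ⟩ := hE'.extend (nsmulAddMonoidHom n : G ⧸ P →+ G ⧸ P) ψb (by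
    intro z hz
    obtain ⟨g, rfl⟩ := QuotientAddGroup.mk'_surjective P z
    have h1 : QuotientAddGroup.mk' P (n • g) = 0 := by rw [map_nsmul]; exact hz
    have h2 : QuotientAddGroup.mk' P g = 0 :=
      (QuotientAddGroup.eq_zero_iff _).2 (hP g ((QuotientAddGroup.eq_zero_iff _).1 h1))
    rw [h2, map_zero])
  let r0 : G →+ E := ψ - (μ.comp θ).comp (QuotientAddGroup.mk' P)
  have hr0 : ∀ g, r0 g = ψ g - μ (θ (QuotientAddGroup.mk' P g)) := fun g => rfl
  have hr0P : ∀ g, r0 g ∈ P' := by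
    intro g
    rw [← QuotientAddGroup.eq_zero_iff]
    show QuotientAddGroup.mk' P' (r0 g) = 0
    rw [hr0, map_sub, hμ, ← map_nsmul, sub_eq_zero]
    exact (hθ (QuotientAddGroup.mk' P g)).symm
  let e := AddMonoidHom.ofInjective hψ
  let r : G →+ G := (e.symm : ψ.range →+ G).comp (r0.codRestrict ψ.range (by
    intro g
    obtain ⟨x, _, hx⟩ := hr0P g
    exact ⟨x, hx⟩))
  have hr : ∀ g, ψ (r g) = r0 g := by
    intro g
    have : e (r g) = ⟨r0 g, _⟩ := e.apply_symm_apply _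
    exact congrArg Subtype.val this
  refine ⟨r, ?_, ?_⟩
  · intro g
    obtain ⟨x, hx, hx2⟩ := hr0P g
    rw [← hr] at hx2
    rw [← hψ hx2]
    exact hx
  · intro x hx
    apply hψ
    rw [hr, hr0]
    have h2 : QuotientAddGroup.mk' P x = 0 := (QuotientAddGroup.eq_zero_iff _).2 hx
    rw [h2, map_zero, map_zero, sub_zero]

theorem exists_retraction_primary {G : Type*} [AddCommGroup G] (p : ℕ) (hp : p.Prime)
    (hfin : {x : G | p • x = 0}.Finite) :
    ∃ r : G →+ G, (∀ g, ∃ k, p ^ k • r g = 0) ∧ ∀ x k, p ^ k • x = 0 → r x = x := by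
  let V : ℕ → Set G := fun n => {y | p • y = 0 ∧ ∃ g, p ^ n • g = y}
  have hVf : ∀ n, (V n).Finite := fun n => hfin.subset (fun y hy => hy.1)
  have hVm : ∀ m n, m ≤ n → V n ⊆ V m := by
    rintro m n hmn y ⟨h1, g, rfl⟩
    obtain ⟨d, rfl⟩ := Nat.exists_eq_add_of_le hmn
    exact ⟨h1, p ^ d • g, by rw [pow_add, mul_smul]⟩
  obtain ⟨k, hk⟩ : ∃ k, ∀ j, k ≤ j → V k ⊆ V j := by
    let k := Function.argmin (fun n => (V n).ncard)
    refine ⟨k, fun j hj => ?_⟩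
    have h1 : (V k).ncard ≤ (V j).ncard := Function.argmin_le (fun n => (V n).ncard) j
    exact (Set.eq_of_subset_of_ncard_le (hVm _ _ hj) h1 (hVf _)).ge
  let P : AddSubgroup G :=
    { carrier := {x | ∃ s, p ^ s • x = 0}
      zero_mem' := ⟨0, by simp⟩
      add_mem' := by
        rintro a b ⟨s, hs⟩ ⟨t, ht⟩
        refine ⟨s + t, ?_⟩
        rw [smul_add, pow_add, mul_smul, mul_smul, ht, smul_comm, hs]
        simp
      neg_mem' := by
        rintro a ⟨s, hs⟩
        exact ⟨s, by rw [smul_neg, hs, neg_zero]⟩ }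
  have hPm : ∀ x, x ∈ P ↔ ∃ s, p ^ s • x = 0 := fun x => Iff.rfl
  let D : AddSubgroup G := P.map (nsmulAddMonoidHom (p ^ k))
  have hDm : ∀ x, x ∈ D ↔ ∃ g ∈ P, p ^ k • g = x := fun x => Iff.rfl
  have hDP : D ≤ P := by
    rintro _ ⟨g, hg, rfl⟩
    exact AddSubgroup.nsmul_mem _ hg _
  have hdp : ∀ j, ∀ y ∈ D, p ^ j • y = 0 → ∃ z ∈ D, p • z = y := by
    intro j
    induction j with
    | zero =>
      intro y _ h
      exact ⟨0, zero_mem _, by simpa using h.symm⟩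
    | succ j ih =>
      rintro y hy h
      have h1 : p ^ j • y ∈ V k := by
        obtain ⟨g, hg, rfl⟩ := (hDm y).1 hy
        refine ⟨by rw [← mul_smul, ← pow_succ']; exact h, p ^ j • g, smul_comm _ _ _⟩
      obtain ⟨_, w, hw⟩ := hk (k + j + 1) (by omega) h1
      have hwP : w ∈ P := by
        refine ⟨k + j + 1 + 1, ?_⟩
        rw [pow_succ', mul_smul, hw, ← mul_smul, ← pow_succ']; exact h
      have hwD : p ^ k • w ∈ D := ⟨w, hwP, rfl⟩
      obtain ⟨z, hz, hzy⟩ := ih (y - p • p ^ k • w)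
        (AddSubgroup.sub_mem _ hy (AddSubgroup.nsmul_mem _ hwD _)) (by
          rw [smul_sub, ← hw, sub_eq_zero, ← mul_smul, ← mul_smul]
          congr 1
          ring)
      exact ⟨z + p ^ k • w, AddSubgroup.add_mem _ hz hwD, by rw [smul_add, hzy]; abel⟩
  have hDdiv : IsDivisibleGrp D := by
    refine IsDivisibleGrp.of_primes ?_
    rintro l hl ⟨y, hy⟩
    obtain ⟨s, hs⟩ := hDP hy
    by_cases hlp : l = p
    · subst hlp
      obtain ⟨z, hz, hzy⟩ := hdp s y hy hs
      exact ⟨⟨z, hz⟩, Subtype.ext hzy⟩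
    · have hcop : IsCoprime ((p ^ s : ℕ) : ℤ) (l : ℤ) :=
        Nat.isCoprime_iff_coprime.2 (Nat.Coprime.pow_left s ((Nat.coprime_primes hp hl).2 (Ne.symm hlp)))
      obtain ⟨a, b, hab⟩ := hcop
      refine ⟨⟨b • y, AddSubgroup.zsmul_mem _ hy _⟩, Subtype.ext ?_⟩
      show l • b • y = y
      conv_rhs => rw [← one_smul ℤ y, ← hab, add_smul, mul_smul, mul_smul, natCast_zsmul, hs,
        smul_zero, zero_add, natCast_zsmul]
      exact smul_comm _ _ _
  obtain ⟨r, hr1, hr2⟩ := exists_retraction (p ^ k) P D (by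
    rintro g ⟨s, hs⟩
    exact ⟨s + k, by rw [pow_add, mul_smul]; exact hs⟩) hDdiv hDP (fun x hx => ⟨x, hx, rfl⟩)
  exact ⟨r, hr1, fun x k hx => hr2 x ⟨k, hx⟩⟩

theorem coBassian_div {G : Type*} [AddCommGroup G] (hG : IsCoBassian G) :
    IsDivisibleGrp (G ⧸ AddCommGroup.torsion G) := by
  refine IsDivisibleGrp.of_primes ?_
  intro p hp d
  have : Fact p.Prime := ⟨hp⟩
  obtain ⟨r, hr1, hr2⟩ := exists_retraction_primary p hp (coBassian_prank hG p)
  have hrr : ∀ g, r (r g) = r g := fun g => by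
    obtain ⟨k, hk⟩ := hr1 g
    exact hr2 _ k hk
  let φ : G →+ G := r + p • (AddMonoidHom.id G - r)
  have hφ : ∀ g, φ g = r g + p • (g - r g) := fun g => rfl
  have hinj : Function.Injective φ := by
    rw [injective_iff_map_eq_zero]
    intro g hg
    have h1 := congrArg r hg
    rw [hφ, map_add, map_nsmul, map_sub, hrr, sub_self, smul_zero, add_zero, map_zero] at h1
    rw [hφ, h1, zero_add, sub_zero] at hg
    rw [← hr2 g 1 (by simpa using hg), h1]
  obtain ⟨g, rfl⟩ := QuotientAddGroup.mk'_surjective _ d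
  obtain ⟨h, rfl⟩ := hG.surj (AddMonoidHom.id G) Function.surjective_id φ hinj g
  refine ⟨QuotientAddGroup.mk' _ (h - r h), ?_⟩
  rw [hφ, map_add, map_nsmul, right_eq_add]
  refine (QuotientAddGroup.eq_zero_iff _).2 ?_
  obtain ⟨k, hk⟩ := hr1 h
  exact isOfFinAddOrder_iff_nsmul_eq_zero.2 ⟨p ^ k, pow_pos hp.pos k, hk⟩

end Splitting

section Sufficiency

theorem finite_nsmul_ker {G : Type*} [AddCommGroup G]
    (h : ∀ p : ℕ, p.Prime → {x : G | p • x = 0}.Finite) :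
    ∀ n : ℕ, 0 < n → {x : G | n • x = 0}.Finite := by
  intro n
  induction n using Nat.recOnMul with
  | zero => intro h; exact absurd h (lt_irrefl 0)
  | one => intro _; simp
  | prime p hp => intro _; exact h p hp
  | mul a b ha hb =>
    intro hab
    have ha := ha (Nat.pos_of_mul_pos_right hab)
    have hb := hb (Nat.pos_of_mul_pos_left hab)
    have : {x : G | (a * b) • x = 0} = (fun x => a • x) ⁻¹' {x | b • x = 0} := by
      ext x
      simp only [Set.mem_ofPred_eq, Set.mem_preimage]
      rw [mul_comm, mul_smul]
    rw [this]
    refine hb.preimage' ?_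
    intro c _
    by_cases hc : ∃ x0 : G, a • x0 = c
    · obtain ⟨x0, rfl⟩ := hc
      refine (ha.image (fun t => x0 + t)).subset ?_
      intro x hx
      have hx' : a • x = a • x0 := hx
      refine ⟨x - x0, ?_, by simp⟩
      show a • (x - x0) = 0
      rw [smul_sub, hx', sub_self]
    · refine Set.finite_empty.subset ?_
      intro x hx
      exact hc ⟨x, hx⟩

theorem card_quot_torsion_le {G : Type*} [AddCommGroup G] (N : AddSubgroup G)
    (hN : N ≤ AddCommGroup.torsion G) (n : ℕ) (hn : 0 < n) (hfin : {x : G | n • x = 0}.Finite)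
    (s : Finset (G ⧸ N)) (hs : ∀ z ∈ s, n • z = 0) : s.card ≤ {x : G | n • x = 0}.ncard := by
  classical
  choose l hl using QuotientAddGroup.mk'_surjective N
  let B : AddSubgroup G := AddSubgroup.closure (s.image l : Finset G)
  have hBT : B ≤ AddCommGroup.torsion G := by
    rw [AddSubgroup.closure_le]
    intro x hx
    rw [Finset.coe_image] at hx
    obtain ⟨z, hz, rfl⟩ := hx
    have h1 : n • l z ∈ N := by
      rw [← QuotientAddGroup.eq_zero_iff]
      show QuotientAddGroup.mk' N (n • l z) = 0
      rw [map_nsmul, hl]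
      exact hs z hz
    obtain ⟨m, hm, hm2⟩ := isOfFinAddOrder_iff_nsmul_eq_zero.1 (hN h1)
    refine isOfFinAddOrder_iff_nsmul_eq_zero.2 ⟨m * n, Nat.mul_pos hm hn, ?_⟩
    rw [mul_smul, hm2]
  have hBfg : AddGroup.FG B := by
    rw [AddGroup.fg_iff_addSubgroup_fg]
    exact ⟨s.image l, rfl⟩
  have hBfin : Finite B := by
    refine AddCommGroup.finite_of_fg_isAddTorsion B ?_
    rw [isAddTorsion_iff_isTorsion_int]
    intro x
    obtain ⟨m, hm, hm2⟩ := isOfFinAddOrder_iff_nsmul_eq_zero.1 (hBT x.2)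
    refine ⟨⟨(m : ℤ), mem_nonZeroDivisors_of_ne_zero (by exact_mod_cast hm.ne')⟩, ?_⟩
    apply Subtype.ext
    show (m : ℤ) • (x : G) = 0
    rw [natCast_zsmul, hm2]
  let α : B →+ G ⧸ N := (QuotientAddGroup.mk' N).comp B.subtype
  let ν : B →+ B := nsmulAddMonoidHom n
  have hα : ∀ b, n • α b = 0 := by
    rintro ⟨b, hb⟩
    show n • QuotientAddGroup.mk' N b = 0
    induction hb using AddSubgroup.closure_induction with
    | mem x hx =>
      rw [Finset.coe_image] at hx
      obtain ⟨z, hz, rfl⟩ := hx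
      rw [hl]
      exact hs z hz
    | zero => simp
    | add x y _ _ hx hy => rw [map_add, smul_add, hx, hy, add_zero]
    | neg x _ hx => rw [map_neg, smul_neg, hx, neg_zero]
  have hle : ν.range ≤ α.ker := by
    rintro _ ⟨b, rfl⟩
    show α (n • b) = 0
    rw [map_nsmul, hα]
  have h1 : Nat.card α.range * Nat.card α.ker = Nat.card B := by
    rw [← AddSubgroup.index_ker, mul_comm, AddSubgroup.card_mul_index]
  have h2 : Nat.card ν.range * Nat.card ν.ker = Nat.card B := by
    rw [← AddSubgroup.index_ker, mul_comm, AddSubgroup.card_mul_index]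
  have h3 : Nat.card ν.range ≤ Nat.card α.ker := AddSubgroup.card_le_of_le hle
  have h4 : 0 < Nat.card ν.range := Nat.card_pos
  have h5 : Nat.card α.range ≤ Nat.card ν.ker := by
    by_contra! hcon
    have : Nat.card ν.range * Nat.card ν.ker < Nat.card α.range * Nat.card α.ker := by
      calc _ < Nat.card ν.range * Nat.card α.range := Nat.mul_lt_mul_of_pos_left hcon h4
        _ ≤ Nat.card α.ker * Nat.card α.range := Nat.mul_le_mul_right _ h3
        _ = _ := mul_comm _ _
    omega
  have h6 : s.card ≤ Nat.card α.range := by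
    have hfr : (α.range : Set (G ⧸ N)).Finite := by
      rw [AddMonoidHom.coe_range]
      exact Set.finite_range α
    rw [← Set.ncard_coe_finset]
    refine Set.ncard_le_ncard ?_ hfr
    intro z hz
    exact ⟨⟨l z, AddSubgroup.subset_closure (by
      rw [Finset.coe_image]; exact ⟨z, hz, rfl⟩)⟩, hl z⟩
  have h7 : Nat.card ν.ker ≤ {x : G | n • x = 0}.ncard := by
    have : Finite {x : G | n • x = 0} := hfin
    refine Nat.card_le_card_of_injective
      (fun x : ν.ker => (⟨x.1.1, congrArg Subtype.val x.2⟩ : {x : G | n • x = 0})) ?_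
    intro x y hxy
    have hxy' : x.1.1 = y.1.1 :=
      congrArg (fun t : {x : G | n • x = 0} => (t : G)) hxy
    exact Subtype.ext (Subtype.ext hxy')
  omega

theorem torsion_surj {G : Type*} [AddCommGroup G] (N : AddSubgroup G)
    (hN : N ≤ AddCommGroup.torsion G) (φ : G →+ G ⧸ N) (hφ : Function.Injective φ)
    (n : ℕ) (hn : 0 < n) (hfin : {x : G | n • x = 0}.Finite) (z : G ⧸ N) (hz : n • z = 0) :
    ∃ g, φ g = z := by
  have hcard := card_quot_torsion_le N hN n hn hfin
  have hf : {z : G ⧸ N | n • z = 0}.Finite := by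
    by_contra hinf
    obtain ⟨t, ht, htc⟩ := Set.Infinite.exists_subset_card_eq hinf ({x : G | n • x = 0}.ncard + 1)
    have := hcard t (fun z hz => ht hz)
    omega
  have hle : {z : G ⧸ N | n • z = 0}.ncard ≤ (φ '' {x : G | n • x = 0}).ncard := by
    rw [Set.ncard_image_of_injective _ hφ, Set.ncard_eq_toFinset_card _ hf]
    exact hcard _ (fun z hz => by simpa using hz)
  have hsub : φ '' {x : G | n • x = 0} ⊆ {z : G ⧸ N | n • z = 0} := by
    rintro _ ⟨x, hx, rfl⟩
    have hx' : n • x = 0 := hx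
    show n • φ x = 0
    rw [← map_nsmul, hx', map_zero]
  have := (Set.eq_of_subset_of_ncard_le hsub hle hf).ge hz
  obtain ⟨g, _, hg⟩ := this
  exact ⟨g, hg⟩

theorem mk_one_injective {V : Type*} [AddCommGroup V] (hV : ∀ n : ℕ, 0 < n → ∀ v : V, n • v = 0 → v = 0)
    (v w : V) (h : (1 : ℚ) ⊗ₜ[ℤ] v = 1 ⊗ₜ w) : v = w := by
  rw [← sub_eq_zero]
  have h1 : TensorProduct.mk ℤ ℚ V 1 (v - w) = 0 := by
    rw [map_sub, sub_eq_zero]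
    exact h
  obtain ⟨c, hc⟩ := (IsLocalizedModule.eq_zero_iff (nonZeroDivisors ℤ) _).1 h1
  have hc0 : (c : ℤ) ≠ 0 := nonZeroDivisors.coe_ne_zero c
  refine hV (c : ℤ).natAbs (Int.natAbs_pos.2 hc0) _ ?_
  have hc' : (c : ℤ) • (v - w) = 0 := hc
  rcases Int.natAbs_eq (c : ℤ) with h | h
  · rw [h, natCast_zsmul] at hc'; exact hc'
  · rw [h, neg_smul, natCast_zsmul, neg_eq_zero] at hc'; exact hc'

theorem rank_argument {V W : Type*} [AddCommGroup V] [AddCommGroup W] (φ π : V →+ W)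
    (hφ : Function.Injective φ) (hπ : Function.Surjective π)
    (hV : ∀ n : ℕ, 0 < n → ∀ v : V, n • v = 0 → v = 0)
    (hW : ∀ n : ℕ, 0 < n → ∀ v : W, n • v = 0 → v = 0)
    (hd : IsDivisibleGrp V) (hf : FiniteDimensional ℚ (ℚ ⊗[ℤ] V)) :
    Function.Injective π ∧ Function.Surjective φ := by
  let Φ : ℚ ⊗[ℤ] V →ₗ[ℚ] ℚ ⊗[ℤ] W := φ.toIntLinearMap.baseChange ℚ
  let Ψ : ℚ ⊗[ℤ] V →ₗ[ℚ] ℚ ⊗[ℤ] W := π.toIntLinearMap.baseChange ℚ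
  have hΦ1 : ∀ v, Φ (1 ⊗ₜ v) = 1 ⊗ₜ φ v := fun v => rfl
  have hΨ1 : ∀ v, Ψ (1 ⊗ₜ v) = 1 ⊗ₜ π v := fun v => rfl
  have : Module.Flat ℤ ℚ := IsLocalization.flat ℚ (nonZeroDivisors ℤ)
  have hΦ : Function.Injective Φ :=
    Module.Flat.lTensor_preserves_injective_linearMap (M := ℚ) φ.toIntLinearMap hφ
  have hΨ : Function.Surjective Ψ := LinearMap.lTensor_surjective ℚ (g := π.toIntLinearMap) hπ
  have hWf : FiniteDimensional ℚ (ℚ ⊗[ℤ] W) := Module.Finite.of_surjective Ψ hΨ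
  have hrank : Module.finrank ℚ (ℚ ⊗[ℤ] V) = Module.finrank ℚ (ℚ ⊗[ℤ] W) :=
    le_antisymm (LinearMap.finrank_le_finrank_of_injective hΦ)
      (LinearMap.finrank_le_finrank_of_surjective hΨ)
  have hΨi : Function.Injective Ψ := (LinearMap.injective_iff_surjective_of_finrank_eq_finrank hrank).2 hΨ
  have hΦs : Function.Surjective Φ := (LinearMap.injective_iff_surjective_of_finrank_eq_finrank hrank).1 hΦ
  have hone : ∀ t : ℚ ⊗[ℤ] V, ∃ v : V, t = 1 ⊗ₜ v := by
    intro t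
    induction t using TensorProduct.induction_on with
    | zero => exact ⟨0, by simp⟩
    | tmul r v =>
      obtain ⟨v', rfl⟩ := hd r.den r.den_pos v
      refine ⟨r.num • v', ?_⟩
      rw [← natCast_zsmul, ← TensorProduct.smul_tmul, ← TensorProduct.smul_tmul]
      congr 1
      simp
    | add a b ha hb =>
      obtain ⟨v, rfl⟩ := ha
      obtain ⟨w, rfl⟩ := hb
      exact ⟨v + w, (TensorProduct.tmul_add _ _ _).symm⟩
  constructor
  · intro v w h
    apply mk_one_injective hV
    apply hΨi
    rw [hΨ1, hΨ1, h]
  · intro w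
    obtain ⟨t, ht⟩ := hΦs (1 ⊗ₜ w)
    obtain ⟨v, rfl⟩ := hone t
    exact ⟨v, mk_one_injective hW _ _ (by rw [← ht, hΦ1])⟩

theorem quot_torsion_free {G : Type*} [AddCommGroup G] (n : ℕ) (hn : 0 < n)
    (v : G ⧸ AddCommGroup.torsion G) (hv : n • v = 0) : v = 0 := by
  obtain ⟨g, rfl⟩ := QuotientAddGroup.mk'_surjective _ v
  rw [← map_nsmul] at hv
  obtain ⟨m, hm, hm2⟩ := isOfFinAddOrder_iff_nsmul_eq_zero.1 ((QuotientAddGroup.eq_zero_iff _).1 hv)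
  refine (QuotientAddGroup.eq_zero_iff _).2
    (isOfFinAddOrder_iff_nsmul_eq_zero.2 ⟨m * n, Nat.mul_pos hm hn, ?_⟩)
  rw [mul_smul, hm2]

theorem coBassian_of {G : Type*} [AddCommGroup G]
    (h1 : ∀ p : ℕ, p.Prime → {x : G | p • x = 0}.Finite)
    (h2 : IsDivisibleGrp (G ⧸ AddCommGroup.torsion G))
    (h3 : FiniteDimensional ℚ (ℚ ⊗[ℤ] (G ⧸ AddCommGroup.torsion G))) : IsCoBassian G := by
  intro N φ hφ
  have hle : ∀ f : G →+ G ⧸ N,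
      AddCommGroup.torsion G ≤ (AddCommGroup.torsion (G ⧸ N)).comap f := by
    intro f x hx
    exact f.isOfFinAddOrder hx
  let Φ := QuotientAddGroup.map _ _ φ (hle φ)
  let Ψ := QuotientAddGroup.map _ _ (QuotientAddGroup.mk' N) (hle _)
  have hΦ : Function.Injective Φ := by
    rw [injective_iff_map_eq_zero]
    intro v hv
    obtain ⟨g, rfl⟩ := QuotientAddGroup.mk'_surjective _ v
    have hv' : φ g ∈ AddCommGroup.torsion (G ⧸ N) := (QuotientAddGroup.eq_zero_iff _).1 hv
    obtain ⟨m, hm, hm2⟩ := isOfFinAddOrder_iff_nsmul_eq_zero.1 hv'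
    refine (QuotientAddGroup.eq_zero_iff _).2
      (isOfFinAddOrder_iff_nsmul_eq_zero.2 ⟨m, hm, ?_⟩)
    rw [← map_nsmul] at hm2
    exact (injective_iff_map_eq_zero φ).1 hφ _ hm2
  have hΨ : Function.Surjective Ψ := by
    intro w
    obtain ⟨z, rfl⟩ := QuotientAddGroup.mk'_surjective _ w
    obtain ⟨g, rfl⟩ := QuotientAddGroup.mk'_surjective _ z
    exact ⟨QuotientAddGroup.mk' _ g, rfl⟩
  obtain ⟨hΨi, hΦs⟩ := rank_argument Φ Ψ hΦ hΨ quot_torsion_free quot_torsion_free h2 h3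
  have hN : N ≤ AddCommGroup.torsion G := by
    intro x hx
    rw [← QuotientAddGroup.eq_zero_iff]
    apply (injective_iff_map_eq_zero Ψ).1 hΨi
    have hx0 : QuotientAddGroup.mk' N x = 0 := (QuotientAddGroup.eq_zero_iff _).2 hx
    show QuotientAddGroup.mk' _ (QuotientAddGroup.mk' N x) = 0
    rw [hx0, map_zero]
  have hts : ∀ z ∈ AddCommGroup.torsion (G ⧸ N), ∃ g, φ g = z := by
    intro z hz
    obtain ⟨m, hm, hm2⟩ := isOfFinAddOrder_iff_nsmul_eq_zero.1 hz
    exact torsion_surj N hN φ hφ m hm (finite_nsmul_ker h1 m hm) z hm2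
  intro z
  obtain ⟨v, hv⟩ := hΦs (QuotientAddGroup.mk' _ z)
  obtain ⟨g, rfl⟩ := QuotientAddGroup.mk'_surjective _ v
  have hv' : QuotientAddGroup.mk' (AddCommGroup.torsion (G ⧸ N)) (z - φ g) = 0 := by
    rw [map_sub, ← hv, sub_eq_zero]
    rfl
  obtain ⟨g', hg'⟩ := hts _ ((QuotientAddGroup.eq_zero_iff _).1 hv')
  exact ⟨g' + g, by rw [map_add, hg', sub_add_cancel]⟩

theorem primary_set_eq (G : Type*) [AddCommGroup G] (p : ℕ) [Fact p.Prime] :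
    {x : G | x ∈ AddCommGroup.primaryComponent G p ∧ p • x = 0} = {x : G | p • x = 0} := by
  ext x
  simp only [Set.mem_ofPred_eq, and_iff_right_iff_imp]
  intro h
  exact ⟨1, by simpa using h⟩

end Sufficiency

/-- `G` is co-Bassian iff each primary component `T_p` has finite `p`-rank
and `G/T` is divisible of finite torsion-free rank. -/
theorem coBassian_iff (G : Type*) [AddCommGroup G] :
    IsCoBassian G ↔
      ((∀ (p : ℕ) [Fact p.Prime],
          {x : G | x ∈ AddCommGroup.primaryComponent G p ∧ p • x = 0}.Finite) ∧
        IsDivisibleGrp (G ⧸ AddCommGroup.torsion G) ∧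
        FiniteDimensional ℚ (ℚ ⊗[ℤ] (G ⧸ AddCommGroup.torsion G))) := by

  constructor
  · intro h
    refine ⟨?_, coBassian_div h, coBassian_finrank h⟩
    intro p hp
    rw [primary_set_eq]
    exact coBassian_prank h p
  · rintro ⟨h1, h2, h3⟩
    refine coBassian_of ?_ h2 h3
    intro p hp
    have : Fact p.Prime := ⟨hp⟩
    rw [← primary_set_eq]
    exact h1 p
end

section
/- An abelian group G is hereditarily generalized co-Bassian (every subgroup of G is generalized co-Bassian) if and only if G is a torsion group and, for each prime p, the subgroup p·T_p of the p-primary component T_p is finitely cogenerated, i.e., (p·T_p)[p] = {x ∈ p·T_p : p·x = 0} is finite. -/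
open scoped TensorProduct DirectSum

lemma fin_order_coe {G : Type*} [AddCommGroup G] {H : AddSubgroup G} {a : H}
    (h : IsOfFinAddOrder (a : G)) : IsOfFinAddOrder a := by
  rw [isOfFinAddOrder_iff_nsmul_eq_zero] at h ⊢
  obtain ⟨n, hn, h⟩ := h
  exact ⟨n, hn, Subtype.ext (by simpa using h)⟩

/-- For finite groups, `m`-torsion does not grow in quotients. -/
lemma card_tors_le_of_surj {F Q : Type*} [AddCommGroup F] [AddCommGroup Q] [Finite F] [Finite Q]
    (f : F →+ Q) (hf : Function.Surjective f) (m : ℕ) :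
    Nat.card (nsmulAddMonoidHom (α := Q) m).ker ≤ Nat.card (nsmulAddMonoidHom (α := F) m).ker := by
  rw [← AddSubgroup.index_range, ← AddSubgroup.index_range]
  have h : (nsmulAddMonoidHom (α := Q) m).range = (nsmulAddMonoidHom (α := F) m).range.map f := by
    ext q
    simp only [AddMonoidHom.mem_range, AddSubgroup.mem_map, nsmulAddMonoidHom_apply]
    constructor
    · rintro ⟨x, rfl⟩
      obtain ⟨y, rfl⟩ := hf x
      exact ⟨m • y, ⟨y, rfl⟩, by simp⟩
    · rintro ⟨_, ⟨y, rfl⟩, rfl⟩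
      exact ⟨f y, by simp⟩
  rw [h]
  exact Nat.le_of_dvd (Nat.pos_of_ne_zero AddSubgroup.FiniteIndex.index_ne_zero)
    (AddSubgroup.index_map_dvd _ hf)

/-- `m`-torsion does not grow in quotients of torsion groups with finite `m`-torsion. -/
lemma card_tors_range_le {A K : Type*} [AddCommGroup A] [AddCommGroup K]
    (hA : ∀ a : A, IsOfFinAddOrder a) (π : A →+ K) (m : ℕ)
    (hfin : {a : A | m • a = 0}.Finite) (t : Set K) (ht : t.Finite)
    (h1 : ∀ x ∈ t, x ∈ π.range ∧ m • x = 0) : t.ncard ≤ {a : A | m • a = 0}.ncard := by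
  classical
  choose! s hs using fun x hx => (h1 x hx).1
  let F : AddSubgroup A := AddSubgroup.closure (s '' t)
  have hFG : AddGroup.FG F := by
    rw [AddGroup.fg_iff_addSubgroup_fg]
    exact ⟨(ht.image s).toFinset, by simp [F]⟩
  have hF : Finite F := by
    have : IsAddTorsion F := fun a => by
      have := hA (a : A)
      exact fin_order_coe this
    exact AddCommGroup.finite_of_fg_isAddTorsion _ this
  let f : F →+ K := π.comp F.subtype
  have : Finite f.range := Set.finite_range f
  have key := card_tors_le_of_surj f.rangeRestrict f.rangeRestrict_surjective m
  have e1 : t.ncard ≤ Nat.card (nsmulAddMonoidHom (α := f.range) m).ker := by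
    rw [← Nat.card_coe_set_eq]
    refine Nat.card_le_card_of_injective
      (fun x : t => (⟨⟨x, ⟨⟨s x, AddSubgroup.subset_closure ⟨x, x.2, rfl⟩⟩, hs x x.2⟩⟩, ?_⟩ :
        (nsmulAddMonoidHom (α := f.range) m).ker)) ?_
    · rw [AddMonoidHom.mem_ker]
      ext
      simpa using (h1 x x.2).2
    · intro x y hxy
      simpa [Subtype.ext_iff] using hxy
  have e2 : Nat.card (nsmulAddMonoidHom (α := F) m).ker ≤ {a : A | m • a = 0}.ncard := by
    rw [← Nat.card_coe_set_eq]
    have := hfin.to_subtype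
    refine Nat.card_le_card_of_injective
      (fun x : (nsmulAddMonoidHom (α := F) m).ker => (⟨((x : F) : A), ?_⟩ : {a : A | m • a = 0})) ?_
    · have := x.2
      rw [AddMonoidHom.mem_ker] at this
      simpa [Subtype.ext_iff] using this
    · intro x y hxy
      have hxy' : ((x : F) : A) = ((y : F) : A) := (Subtype.mk.injEq ..).mp hxy
      exact Subtype.ext (Subtype.ext hxy')
  omega

lemma mem_range_of_inj {A K : Type*} [AddCommGroup A] [AddCommGroup K]
    (hA : ∀ a : A, IsOfFinAddOrder a) (π φ : A →+ K) (m : ℕ)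
    (hfin : {a : A | m • a = 0}.Finite) (hφ : Function.Injective φ)
    (hle : ∀ a, φ a ∈ π.range) (x : K) (hx : x ∈ π.range) (hmx : m • x = 0) : x ∈ φ.range := by
  by_contra hn
  have hfi := hfin.image φ
  have hx' : x ∉ φ '' {a : A | m • a = 0} := by
    rintro ⟨a, -, rfl⟩
    exact hn ⟨a, rfl⟩
  have := card_tors_range_le hA π m hfin (insert x (φ '' {a : A | m • a = 0})) (hfi.insert x) (by
    rintro y (rfl | ⟨a, ha, rfl⟩)
    · exact ⟨hx, hmx⟩
    · refine ⟨hle a, ?_⟩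
      have ha : m • a = 0 := ha
      rw [← map_nsmul, ha, map_zero])
  rw [Set.ncard_insert_of_notMem hx' hfi, Set.ncard_image_of_injective _ hφ] at this
  omega

/-- Finite `p`-torsion gives finite `p^n`-torsion. -/
lemma finite_tors_pow {A : Type*} [AddCommGroup A] (p : ℕ) (h : {a : A | p • a = 0}.Finite) (n : ℕ) :
    {a : A | p ^ n • a = 0}.Finite := by
  induction n with
  | zero => simp
  | succ n ih =>
    refine Set.Finite.of_finite_fibers (fun a => p • a) (ih.subset ?_) ?_
    · rintro _ ⟨a, ha, rfl⟩
      have ha : p ^ (n+1) • a = 0 := ha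
      show p ^ n • p • a = 0
      rwa [smul_smul, ← pow_succ]
    · rintro _ ⟨a, ha, rfl⟩
      refine (h.image (fun b => a + b)).subset ?_
      rintro c ⟨-, hc⟩
      have hc : p • c = p • a := hc
      exact ⟨c - a, by simp [smul_sub, hc], by simp⟩

lemma mem_of_primary {K : Type*} [AddCommGroup K] (L : AddSubgroup K)
    (hL : ∀ p : ℕ, p.Prime → ∀ n : ℕ, ∀ k : K, p ^ n • k = 0 → k ∈ L) (m : ℕ) :
    0 < m → ∀ k : K, m • k = 0 → k ∈ L := by
  induction m using Nat.recOnPosPrimePosCoprime with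
  | zero => simp
  | one => intro _ k hk; simp at hk; simp [hk]
  | prime_pow p n hp hn => exact fun _ k hk => hL p hp n k hk
  | coprime a b ha hb hab iha ihb =>
    intro _ k hk
    have h1 : (a : ℤ) * a.gcdA b + b * a.gcdB b = 1 := by
      rw [← Nat.gcd_eq_gcd_ab, hab]; rfl
    have hk' : ((a * b : ℕ) : ℤ) • k = 0 := by rw [natCast_zsmul, hk]
    have : k = a.gcdA b • ((a : ℤ) • k) + a.gcdB b • ((b : ℤ) • k) := by
      rw [smul_smul, smul_smul, ← add_smul, mul_comm, mul_comm (a.gcdB b), h1, one_smul]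
    rw [this]
    refine L.add_mem (L.zsmul_mem (ihb (by omega) _ ?_) _) (L.zsmul_mem (iha (by omega) _ ?_) _)
    · rw [← natCast_zsmul, smul_smul, ← hk']; push_cast; ring_nf
    · rw [← natCast_zsmul, smul_smul, ← hk']; push_cast; ring_nf

/-- If `⊤ = R + socle` then `R` is a direct summand. -/
lemma summand_of_socle {K : Type*} [AddCommGroup K] (R : AddSubgroup K)
    (h : ∀ L : AddSubgroup K, R ≤ L → (∀ p : ℕ, p.Prime → ∀ x, p • x = 0 → x ∈ L) → L = ⊤) :
    IsDirectSummand R := by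
  let S : Submodule ℤ K := ⨆ p ∈ {p : ℕ | p.Prime}, Submodule.torsionBy ℤ K (p : ℤ)
  have hS : IsSemisimpleModule ℤ S :=
    isSemisimpleModule_biSup_of_isSemisimpleModule_submodule fun p hp =>
      Submodule.isSemisimple_torsionBy_of_irreducible (Nat.prime_iff_prime_int.1 hp).irreducible
  obtain ⟨C, hC⟩ := exists_isCompl ((AddSubgroup.toIntSubmodule R).comap S.subtype)
  let C' : Submodule ℤ K := C.map S.subtype
  have hsup : (AddSubgroup.toIntSubmodule R).comap S.subtype ⊔ C = ⊤ := hC.sup_eq_top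
  have hinf : (AddSubgroup.toIntSubmodule R).comap S.subtype ⊓ C = ⊥ := hC.inf_eq_bot
  have hSle : ∀ x ∈ S, x ∈ R ⊔ C'.toAddSubgroup := by
    intro x hx
    have : (⟨x, hx⟩ : S) ∈ (AddSubgroup.toIntSubmodule R).comap S.subtype ⊔ C := by
      rw [hsup]; trivial
    obtain ⟨a, ha, b, hb, hab⟩ := Submodule.mem_sup.1 this
    refine AddSubgroup.mem_sup.2 ⟨a, ha, b, ⟨b, hb, rfl⟩, ?_⟩
    simpa [Subtype.ext_iff] using hab
  refine ⟨C'.toAddSubgroup, h _ le_sup_left fun p hp x hx => hSle x ?_, ?_⟩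
  · refine (le_biSup (fun p : ℕ => Submodule.torsionBy ℤ K (p : ℤ)) (i := p) hp) ?_
    rw [Submodule.mem_torsionBy_iff, natCast_zsmul, hx]
  · rw [eq_bot_iff]
    rintro _ ⟨hxR, ⟨b, hb, rfl⟩⟩
    have : b ∈ (AddSubgroup.toIntSubmodule R).comap S.subtype ⊓ C := ⟨hxR, hb⟩
    rw [hinf] at this
    simp [(Submodule.mem_bot _).1 this]

lemma exists_primary_lift {G : Type*} [AddCommGroup G] (hG : ∀ a : G, IsOfFinAddOrder a)
    (N : AddSubgroup G) (p : ℕ) (hp : p.Prime) (n : ℕ) (k : G ⧸ N) (hk : p ^ n • k = 0) :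
    ∃ g : G, (∃ j : ℕ, p ^ j • g = 0) ∧ (g : G ⧸ N) = k := by
  obtain ⟨g, rfl⟩ := QuotientAddGroup.mk_surjective k
  obtain ⟨d, hd, hdg⟩ := isOfFinAddOrder_iff_nsmul_eq_zero.1 (hG g)
  obtain ⟨j, m, hm, rfl⟩ := Nat.exists_eq_pow_mul_and_not_dvd hd.ne' p hp.ne_one
  have hcop : Nat.Coprime m (p ^ n) := 
    Nat.Coprime.pow_right _ ((Nat.Prime.coprime_iff_not_dvd hp).2 hm).symm
  have h1 : (m : ℤ) * m.gcdA (p ^ n) + (p ^ n : ℕ) * m.gcdB (p ^ n) = 1 := by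
    rw [← Nat.gcd_eq_gcd_ab, hcop]; rfl
  refine ⟨((m : ℤ) * m.gcdA (p ^ n)) • g, ⟨j, ?_⟩, ?_⟩
  · have hdg' : ((p ^ j * m : ℕ) : ℤ) • g = 0 := by rw [natCast_zsmul, hdg]
    rw [← natCast_zsmul, smul_smul, ← mul_assoc, mul_comm, mul_smul]
    rw [Nat.cast_mul] at hdg'
    rw [hdg', smul_zero]
  · have hk' : ((p ^ n : ℕ) : ℤ) • (g : G ⧸ N) = 0 := by rw [natCast_zsmul, hk]
    rw [QuotientAddGroup.mk_zsmul]
    have : ((m : ℤ) * m.gcdA (p ^ n) + (p ^ n : ℕ) * m.gcdB (p ^ n)) • (g : G ⧸ N) = g := by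
      rw [h1, one_smul]
    rw [add_smul, mul_comm ((p ^ n : ℕ) : ℤ), mul_smul _ ((p ^ n : ℕ) : ℤ), hk', smul_zero, add_zero] at this
    exact this

lemma genCoBassian_of {G : Type*} [AddCommGroup G] (hG : ∀ a : G, IsOfFinAddOrder a)
    (hfin : ∀ p : ℕ, p.Prime →
      {x : G | (∃ y, (∃ j : ℕ, p ^ j • y = 0) ∧ p • y = x) ∧ p • x = 0}.Finite) :
    IsGenCoBassian G := by
  intro N φ hφ
  refine summand_of_socle _ fun L hRL hL => ?_
  rw [eq_top_iff]
  rintro k -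
  have key : ∀ p : ℕ, p.Prime → ∀ n : ℕ, ∀ k : G ⧸ N, p ^ n • k = 0 → k ∈ L := by
    intro p hp n k hk
    have : Fact p.Prime := ⟨hp⟩
    let A : AddSubgroup G := (AddCommGroup.primaryComponent G p).map (nsmulAddMonoidHom p)
    have hAmem : ∀ x, x ∈ A ↔ ∃ y, (∃ j : ℕ, p ^ j • y = 0) ∧ p • y = x := fun x => Iff.rfl
    have hAf : {a : A | p • a = 0}.Finite := by
      refine Set.Finite.of_finite_image (f := Subtype.val) ((hfin p hp).subset ?_)
        Subtype.val_injective.injOn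
      rintro _ ⟨a, ha, rfl⟩
      exact ⟨(hAmem _).1 a.2, congrArg Subtype.val (show p • a = 0 from ha)⟩
    have hlift : ∀ (n : ℕ) (k : G ⧸ N), p ^ n • k = 0 →
        p • k ∈ ((QuotientAddGroup.mk' N).comp A.subtype).range := by
      intro n k hk
      obtain ⟨g, hg, rfl⟩ := exists_primary_lift hG N p hp n k hk
      exact ⟨⟨p • g, (hAmem _).2 ⟨g, hg, rfl⟩⟩, by simp⟩
    have := mem_range_of_inj (A := A) (fun a => by
        have := hG (a : G)
        exact fin_order_coe this)
      ((QuotientAddGroup.mk' N).comp A.subtype) (φ.comp A.subtype) (p ^ n)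
      (finite_tors_pow p hAf n) (hφ.comp Subtype.val_injective) (by
        rintro ⟨a, ha⟩
        obtain ⟨y, ⟨j, hj⟩, rfl⟩ := (hAmem a).1 ha
        have := hlift j (φ y) (by rw [← map_nsmul, hj, map_zero])
        simpa using this) (p • k) (hlift n k hk) (by rw [smul_comm, hk, smul_zero])
    obtain ⟨⟨a, ha⟩, hak⟩ := this
    obtain ⟨y, -, rfl⟩ := (hAmem a).1 ha
    have hak : φ (p • y) = p • k := hak
    have h2 : k - φ y ∈ L := hL p hp _ (by rw [smul_sub, ← hak, map_nsmul, sub_self])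
    have h3 := L.add_mem h2 (hRL ⟨y, rfl⟩)
    simpa using h3
  obtain ⟨g, rfl⟩ := QuotientAddGroup.mk_surjective k
  obtain ⟨d, hd, hdg⟩ := isOfFinAddOrder_iff_nsmul_eq_zero.1 (hG g)
  refine mem_of_primary L key d hd _ ?_
  rw [← QuotientAddGroup.mk_nsmul, hdg, QuotientAddGroup.mk_zero]

/-- In a generalized co-Bassian group the image of an injective endomorphism is pure. -/
lemma pure_of_gen {H : Type*} [AddCommGroup H] (hH : IsGenCoBassian H) (ψ : H →+ H)
    (hψ : Function.Injective ψ) (n : ℕ) (x y : H) (hxy : n • x = ψ y) :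
    ∃ c, n • x = n • ψ c := by
  have hinj : Function.Injective (QuotientAddGroup.mk' (⊥ : AddSubgroup H)) := by
    rw [← AddMonoidHom.ker_eq_bot_iff, QuotientAddGroup.ker_mk']
  obtain ⟨C, h1, h2⟩ := hH ⊥ ((QuotientAddGroup.mk' ⊥).comp ψ) (hinj.comp hψ)
  have hx : (QuotientAddGroup.mk' (⊥ : AddSubgroup H)) x ∈
      ((QuotientAddGroup.mk' ⊥).comp ψ).range ⊔ C := by rw [h1]; trivial
  obtain ⟨_, ⟨c, rfl⟩, d, hd, hcd⟩ := AddSubgroup.mem_sup.1 hx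
  refine ⟨c, hinj ?_⟩
  have h3 : n • d = (QuotientAddGroup.mk' (⊥ : AddSubgroup H)) (ψ (y - n • c)) := by
    rw [map_sub, ← hxy, map_nsmul, map_sub, map_nsmul, ← hcd, smul_add, map_nsmul]
    simp
  have h4 : n • d ∈ ((QuotientAddGroup.mk' ⊥).comp ψ).range ⊓ C :=
    ⟨⟨y - n • c, h3.symm⟩, C.nsmul_mem hd n⟩
  rw [h2] at h4
  have h5 : n • d = 0 := h4
  rw [map_nsmul, ← hcd, smul_add, h5, add_zero, map_nsmul]
  rfl

lemma torsion_of_her {G : Type*} [AddCommGroup G] (h : ∀ H : AddSubgroup G, IsGenCoBassian H)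
    (x : G) : IsOfFinAddOrder x := by
  by_contra hx
  rw [← injective_zsmul_iff_not_isOfFinAddOrder] at hx
  have hz : ∀ k : ℤ, k • x = 0 → k = 0 := fun k hk => hx (by simpa using hk)
  have hinj : Function.Injective (nsmulAddMonoidHom (α := AddSubgroup.zmultiples x) 2) := by
    rw [injective_iff_map_eq_zero]
    rintro ⟨_, k, rfl⟩ hk
    have hk : 2 • (k • x) = 0 := congrArg Subtype.val hk
    rw [← natCast_zsmul, smul_smul] at hk
    have := hz _ hk
    have : k = 0 := by push_cast at this; omega
    subst this
    ext; simp
  obtain ⟨⟨_, k, rfl⟩, hc⟩ := pure_of_gen (h (AddSubgroup.zmultiples x)) _ hinj 2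
    ⟨x, AddSubgroup.mem_zmultiples x⟩ ⟨x, AddSubgroup.mem_zmultiples x⟩ rfl
  have hc : 2 • x = 2 • (2 • (k • x)) := congrArg Subtype.val hc
  have := hz (2 - 2 * (2 * k)) (by
    rw [sub_smul, mul_smul, mul_smul, sub_eq_zero]
    simpa [← natCast_zsmul] using hc)
  omega

/-- The embedding `ℤ/p → ℤ/p²`. -/
noncomputable def zmodEmb (p : ℕ) : ZMod p →+ ZMod (p ^ 2) :=
  ZMod.lift p ⟨(zmultiplesHom (ZMod (p ^ 2))) (p : ZMod (p ^ 2)), by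
    simp only [zmultiplesHom_apply, natCast_zsmul, nsmul_eq_mul]
    rw [← Nat.cast_mul, ← pow_two, ZMod.natCast_self]⟩

lemma zmodEmb_intCast (p : ℕ) (k : ℤ) : zmodEmb p (k : ZMod p) = ((k * p : ℤ) : ZMod (p ^ 2)) := by
  simp [zmodEmb]

lemma zmodEmb_injective (p : ℕ) (hp : p.Prime) : Function.Injective (zmodEmb p) := by
  rw [injective_iff_map_eq_zero]
  intro a ha
  obtain ⟨k, rfl⟩ := ZMod.intCast_surjective a
  rw [zmodEmb_intCast, ZMod.intCast_zmod_eq_zero_iff_dvd] at ha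
  rw [ZMod.intCast_zmod_eq_zero_iff_dvd]
  push_cast at ha
  rw [pow_two] at ha
  exact Int.dvd_of_mul_dvd_mul_right (by exact_mod_cast hp.ne_zero) ha

lemma smul_zmodEmb (p : ℕ) (a : ZMod p) : p • zmodEmb p a = 0 := by
  obtain ⟨k, rfl⟩ := ZMod.intCast_surjective a
  rw [← map_nsmul]
  simp

abbrev Mgrp (p : ℕ) := (ℕ →₀ ZMod (p ^ 2)) × (ℕ →₀ ZMod p)

noncomputable def thetaHom (p : ℕ) : Mgrp p →+ (ℕ →₀ ZMod (p ^ 2)) :=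
  (Finsupp.mapDomain.addMonoidHom (fun i => 2 * i)).coprod
    ((Finsupp.mapDomain.addMonoidHom (fun i => 2 * i + 1)).comp
      (Finsupp.mapRange.addMonoidHom (zmodEmb p)))

lemma thetaHom_even (p : ℕ) (x : Mgrp p) (i : ℕ) : thetaHom p x (2 * i) = x.1 i := by
  have h1 : Function.Injective (fun i : ℕ => 2 * i) := fun a b h => by simpa using h
  simp only [thetaHom, AddMonoidHom.coprod_apply, Finsupp.add_apply, AddMonoidHom.comp_apply,
    Finsupp.mapDomain.addMonoidHom_apply]
  rw [Finsupp.mapDomain_apply h1 x.1 i, Finsupp.mapDomain_of_notMem_range, add_zero]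
  rintro ⟨j, hj⟩
  simp only at hj
  omega

lemma thetaHom_odd (p : ℕ) (x : Mgrp p) (i : ℕ) :
    thetaHom p x (2 * i + 1) = zmodEmb p (x.2 i) := by
  have h1 : Function.Injective (fun i : ℕ => 2 * i + 1) := fun a b h => by simpa using h
  simp only [thetaHom, AddMonoidHom.coprod_apply, Finsupp.add_apply, AddMonoidHom.comp_apply,
    Finsupp.mapDomain.addMonoidHom_apply]
  rw [Finsupp.mapDomain_apply h1 _ i, Finsupp.mapDomain_of_notMem_range, zero_add]
  · rfl
  rintro ⟨j, hj⟩
  simp only at hj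
  omega

lemma thetaHom_injective (p : ℕ) (hp : p.Prime) : Function.Injective (thetaHom p) := by
  intro x y h
  refine Prod.ext (Finsupp.ext fun i => ?_) (Finsupp.ext fun i => ?_)
  · rw [← thetaHom_even, h, thetaHom_even]
  · apply zmodEmb_injective p hp
    rw [← thetaHom_odd, h, thetaHom_odd]

lemma gen_equiv_false {H : Type*} [AddCommGroup H] (p : ℕ) (hp : p.Prime) (e : Mgrp p ≃+ H)
    (hH : IsGenCoBassian H) : False := by
  let φ : Mgrp p →+ Mgrp p := (thetaHom p).prod 0
  have hφ : Function.Injective φ := fun x y h => thetaHom_injective p hp (congrArg Prod.fst h)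
  let ψ : H →+ H := (e.toAddMonoidHom.comp φ).comp e.symm.toAddMonoidHom
  have hψ : Function.Injective ψ := (e.injective.comp hφ).comp e.symm.injective
  have hx : p • ((Finsupp.single 1 1, 0) : Mgrp p) = φ (0, Finsupp.single 0 1) := by
    refine Prod.ext (Finsupp.ext fun i => ?_) (by simp [φ])
    obtain ⟨j, rfl | rfl⟩ := Nat.even_or_odd' i
    · show p • (Finsupp.single 1 (1 : ZMod (p ^ 2))) (2 * j) = thetaHom p _ (2 * j)
      rw [thetaHom_even, Finsupp.single_eq_of_ne (by omega)]
      simp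
    · show p • (Finsupp.single 1 (1 : ZMod (p ^ 2))) (2 * j + 1) = thetaHom p _ (2 * j + 1)
      rw [thetaHom_odd]
      rcases Nat.eq_zero_or_pos j with rfl | hj
      · have := zmodEmb_intCast p 1
        simp only [Int.cast_one] at this
        simp [this]
      · rw [Finsupp.single_eq_of_ne (by omega), Finsupp.single_eq_of_ne (by omega)]
        simp
  obtain ⟨c, hc⟩ := pure_of_gen hH ψ hψ p (e (Finsupp.single 1 1, 0)) (e (0, Finsupp.single 0 1))
    (by rw [← map_nsmul, hx]; simp [ψ])
  have hc' : p • ((Finsupp.single 1 1, 0) : Mgrp p) = p • φ (e.symm c) := by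
    apply e.injective
    rw [map_nsmul, hc, map_nsmul]; rfl
  have h1 := DFunLike.congr_fun (congrArg Prod.fst hc') (2 * 0 + 1)
  have h2 : p • (Finsupp.single 1 (1 : ZMod (p ^ 2))) (2 * 0 + 1)
      = p • thetaHom p (e.symm c) (2 * 0 + 1) := h1
  rw [thetaHom_odd, smul_zmodEmb] at h2
  simp only [mul_zero, zero_add, Finsupp.single_eq_same, nsmul_eq_mul, mul_one] at h2
  rw [ZMod.natCast_eq_zero_iff] at h2
  have := Nat.le_of_dvd hp.pos h2
  have := hp.one_lt
  nlinarith

lemma bigHom_exists {G : Type*} [AddCommGroup G] (p : ℕ) (b y : ℕ → G)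
    (hb : ∀ (s : Finset ℕ) (c : ℕ → ℤ), ∑ i ∈ s, c i • b i = 0 → ∀ i ∈ s, (p : ℤ) ∣ c i)
    (hpb : ∀ i, p • b i = 0) (hy : ∀ i, p • y i = b i) :
    ∃ Θ : (ℕ →₀ ZMod (p ^ 2)) →+ G, Function.Injective Θ := by
  have hp2 : ∀ i, p ^ 2 • y i = 0 := fun i => by rw [pow_two, mul_smul, hy, hpb]
  let L : ∀ i, ZMod (p ^ 2) →+ G := fun i => ZMod.lift (p ^ 2) ⟨zmultiplesHom G (y i), by
    simp only [zmultiplesHom_apply, natCast_zsmul, hp2]⟩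
  have hL : ∀ i (k : ℤ), L i (k : ZMod (p ^ 2)) = k • y i := fun i k => by simp [L]
  refine ⟨Finsupp.liftAddHom L, ?_⟩
  rw [injective_iff_map_eq_zero]
  intro f hf
  choose c hc using fun i => ZMod.intCast_surjective (f i)
  have h0 : ∑ i ∈ f.support, c i • y i = 0 := by
    rw [← hf, Finsupp.liftAddHom_apply, Finsupp.sum]
    exact Finset.sum_congr rfl fun i _ => by rw [← hc, hL]
  have h1 : ∑ i ∈ f.support, c i • b i = 0 := by
    have := congrArg (fun z => p • z) h0
    simp only [Finset.smul_sum, smul_zero] at this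
    rw [← this]
    exact Finset.sum_congr rfl fun i _ => by rw [smul_comm, hy]
  have h2 := hb _ _ h1
  choose! d hd using h2
  have h3 : ∑ i ∈ f.support, d i • b i = 0 := by
    rw [← h0]
    exact Finset.sum_congr rfl fun i hi => by
      rw [hd i hi, mul_comm, mul_smul, natCast_zsmul, hy]
  have h4 := hb _ _ h3
  ext i
  by_cases hi : i ∈ f.support
  · obtain ⟨k, hk⟩ := h4 i hi
    rw [← hc, hd i hi, hk, Finsupp.zero_apply, ZMod.intCast_zmod_eq_zero_iff_dvd]
    exact ⟨k, by push_cast; ring⟩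
  · simpa using hi

lemma exists_seq_li (k V : Type*) [Field k] [Finite k] [AddCommGroup V] [Module k V] [Infinite V] :
    ∃ B : ℕ → V, LinearIndependent k B := by
  let B := Module.Basis.ofVectorSpace k V
  have hι : Infinite (Module.Basis.ofVectorSpaceIndex k V) := by
    by_contra hfin
    rw [not_infinite_iff_finite] at hfin
    have : Module.Finite k V := Module.Finite.of_basis B
    have : Finite V := Module.finite_of_finite k
    exact not_finite V
  let em := Infinite.natEmbedding (Module.Basis.ofVectorSpaceIndex k V)
  exact ⟨_, B.linearIndependent.comp em em.injective⟩

lemma finite_of_her {G : Type*} [AddCommGroup G] (h : ∀ H : AddSubgroup G, IsGenCoBassian H)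
    (p : ℕ) [hp : Fact p.Prime] : {x : G | (∃ y ∈ AddCommGroup.primaryComponent G p, p • y = x) ∧
            p • x = 0}.Finite := by
  by_contra hinf
  let V : AddSubgroup G := (AddCommGroup.primaryComponent G p).map (nsmulAddMonoidHom p) ⊓
    (nsmulAddMonoidHom p).ker
  have hVinf : Infinite V := (show (V : Set G).Infinite from hinf).to_subtype
  have hV : ∀ x : V, p • x = 0 := fun x => Subtype.ext x.2.2
  let _ : Module (ZMod p) V := AddCommGroup.zmodModule hV
  obtain ⟨B, hli⟩ := exists_seq_li (ZMod p) V
  have hex : ∀ i, ∃ y : G, p • y = (B i : G) := fun i => by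
    obtain ⟨y, -, hy⟩ := (B i).2.1
    exact ⟨y, hy⟩
  choose y hy using hex
  obtain ⟨Θ, hΘ⟩ := bigHom_exists p (fun i => (B i : G)) y (by
    intro s c hs i hi
    rw [linearIndependent_iff'] at hli
    have := hli s (fun i => (c i : ZMod p)) (by
      apply Subtype.ext
      rw [AddSubgroup.val_finsetSum, ZeroMemClass.coe_zero, ← hs]
      refine Finset.sum_congr rfl fun i _ => ?_
      rw [Int.cast_smul_eq_zsmul]; rfl) i hi
    rwa [ZMod.intCast_zmod_eq_zero_iff_dvd] at this) (fun i => congrArg Subtype.val (hV _)) hy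
  let Ξ := Θ.comp (thetaHom p)
  have hΞ : Function.Injective Ξ := hΘ.comp (thetaHom_injective p hp.out)
  exact gen_equiv_false p hp.out (AddMonoidHom.ofInjective hΞ) (h _)

/-- `G` is hereditarily generalized co-Bassian iff `G` is torsion and, for
each prime `p`, the subgroup `p·T_p` is finitely cogenerated, i.e. `(p·T_p)[p]` is finite. -/
theorem hereditarilyGenCoBassian_iff (G : Type*) [AddCommGroup G] :
    (∀ H : AddSubgroup G, IsGenCoBassian H) ↔
      (AddMonoid.IsTorsion G ∧
        ∀ (p : ℕ) [Fact p.Prime],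
          {x : G | (∃ y ∈ AddCommGroup.primaryComponent G p, p • y = x) ∧
            p • x = 0}.Finite) := by
  constructor
  · intro h
    exact ⟨fun x => torsion_of_her h x, fun p _ => finite_of_her h p⟩
  · rintro ⟨ht, hf⟩ H
    refine genCoBassian_of (fun a => fin_order_coe (ht a)) fun p hp => ?_
    have : Fact p.Prime := ⟨hp⟩
    refine Set.Finite.of_finite_image (f := Subtype.val) ((hf p).subset ?_)
      Subtype.val_injective.injOn
    rintro _ ⟨x, ⟨⟨y, ⟨j, hj⟩, rfl⟩, hx⟩, rfl⟩
    exact ⟨⟨y, ⟨j, congrArg Subtype.val hj⟩, rfl⟩, congrArg Subtype.val hx⟩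
end

section
/- An abelian group G is super co-Bassian (every quotient group of G is co-Bassian) if and only if G is co-Bassian. -/
open scoped TensorProduct DirectSum

namespace CoB

theorem crit {G : Type*} [AddCommGroup G] (hG : IsCoBassian G) {H : Type*} [AddCommGroup H]
    (f g : G →+ H) (hf : Function.Surjective f) (hg : Function.Injective g) :
    Function.Surjective g := by
  let e := QuotientAddGroup.quotientKerEquivOfSurjective f hf
  have h := hG f.ker (e.symm.toAddMonoidHom.comp g) (e.symm.injective.comp hg)
  intro y
  obtain ⟨x, hx⟩ := h (e.symm y)
  exact ⟨x, e.symm.injective hx⟩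

/-- divisible groups have the extension property -/
theorem ext_of_div {E : Type*} [AddCommGroup E]
    (hE : ∀ n : ℕ, 0 < n → ∀ d : E, ∃ x : E, n • x = d)
    {X G : Type*} [AddCommGroup X] [AddCommGroup G] (i : X →+ G) (hi : Function.Injective i)
    (u : X →+ E) : ∃ w : G →+ E, ∀ x, w (i x) = u x := by
  classical
  have hE' : ∀ n : ℤ, n ≠ 0 → ∀ d : E, ∃ x : E, n • x = d := by
    intro n hn d
    obtain ⟨x, hx⟩ := hE n.natAbs (Int.natAbs_pos.mpr hn) d
    rcases Int.natAbs_eq n with h | h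
    · exact ⟨x, by rw [h, natCast_zsmul, hx]⟩
    · exact ⟨-x, by rw [h, neg_smul_neg, natCast_zsmul, hx]⟩
  let _ : DivisibleBy E ℤ := 
    { div := fun d n => if h : n ≠ 0 then (hE' n h d).choose else 0
      div_zero := by intro a; simp
      div_cancel := by
        intro n a hn
        simp only [dif_pos hn]
        exact (hE' n hn a).choose_spec }
  obtain ⟨h, hh⟩ := (Module.Baer.of_divisible E).extension_property_addMonoidHom i hi u
  exact ⟨h, fun x => DFunLike.congr_fun hh x⟩

/-- Key lemma. -/
theorem keyA {G : Type*} [AddCommGroup G] (hG : IsCoBassian G)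
    {E : Type*} [AddCommGroup E]
    (hE : ∀ n : ℕ, 0 < n → ∀ d : E, ∃ x : E, n • x = d)
    {X : Type*} [AddCommGroup X] (i : X →+ G) (hi : Function.Injective i)
    (u v : X →+ E) (hu : Function.Surjective u) (hv : Function.Injective v) :
    Function.Surjective v := by
  obtain ⟨u', hu'⟩ := ext_of_div hE i hi u
  obtain ⟨v', hv'⟩ := ext_of_div hE i hi v
  let q := QuotientAddGroup.mk' i.range
  have hs := crit hG (u'.prod q) (v'.prod q) ?_ ?_
  · intro e
    obtain ⟨g, hg⟩ := hs (e, 0)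
    have h1 : v' g = e := congrArg Prod.fst hg
    have h2 : q g = 0 := congrArg Prod.snd hg
    obtain ⟨x, rfl⟩ := (QuotientAddGroup.eq_zero_iff g).mp h2
    exact ⟨x, by rw [← hv', h1]⟩
  · rintro ⟨e, y⟩
    obtain ⟨g, rfl⟩ := QuotientAddGroup.mk'_surjective _ y
    obtain ⟨x, hx⟩ := hu (e - u' g)
    refine ⟨g + i x, Prod.ext ?_ ?_⟩
    · show u' (g + i x) = e
      rw [map_add, hu', hx]; abel
    · show q (g + i x) = q g
      rw [map_add, show q (i x) = 0 from
        (QuotientAddGroup.eq_zero_iff (N := i.range) (i x)).mpr ⟨x, rfl⟩, add_zero]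
  · rw [injective_iff_map_eq_zero]
    intro g hg
    have h1 : v' g = 0 := congrArg Prod.fst hg
    have h2 : q g = 0 := congrArg Prod.snd hg
    obtain ⟨x, rfl⟩ := (QuotientAddGroup.eq_zero_iff g).mp h2
    rw [hv'] at h1
    rw [(injective_iff_map_eq_zero v).mp hv x h1, map_zero]

theorem finsupp_div {P : Type*} [AddCommGroup P]
    (hP : ∀ n : ℕ, 0 < n → ∀ d : P, ∃ x : P, n • x = d) :
    ∀ n : ℕ, 0 < n → ∀ d : ℕ →₀ P, ∃ x : ℕ →₀ P, n • x = d := by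
  classical
  intro n hn d
  choose f hf using hP n hn
  refine ⟨d.mapRange (fun a => if a = 0 then 0 else f a) (by simp), ?_⟩
  ext k
  by_cases h : d k = 0 <;> simp [h, hf]

/-- finite torsion-free rank -/
theorem rank_fin {G : Type*} [AddCommGroup G] (hG : IsCoBassian G) :
    Module.rank ℤ G < Cardinal.aleph0 := by
  by_contra hcon
  push Not at hcon
  obtain ⟨s, hs, hli⟩ := exists_set_linearIndependent_of_isDomain ℤ G
  have hinf : Infinite s := by
    rw [Cardinal.infinite_iff, hs]; exact hcon
  let em := Infinite.natEmbedding s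
  have hli' : LinearIndependent ℤ (fun n : ℕ => ((em n : s) : G)) :=
    hli.comp em em.injective
  obtain ⟨w, hw⟩ := exists_surjective_nat (ℕ →₀ ℚ)
  have := keyA hG (E := ℕ →₀ ℚ) (finsupp_div (by
      intro n hn d
      refine ⟨d / n, ?_⟩
      have : (n : ℚ) ≠ 0 := by exact_mod_cast hn.ne'
      rw [nsmul_eq_mul]; field_simp))
    (Finsupp.linearCombination ℤ (fun n : ℕ => ((em n : s) : G))).toAddMonoidHom hli'
    (Finsupp.linearCombination ℤ w).toAddMonoidHom
    (Finsupp.mapRange.addMonoidHom (Int.castAddHom ℚ)) (by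
      intro e
      obtain ⟨n, rfl⟩ := hw e
      exact ⟨Finsupp.single n 1, by simp⟩) (by
      apply Finsupp.mapRange_injective
      · simp
      · intro a b h; simpa using h)
  obtain ⟨x, hx⟩ := this (Finsupp.single 0 (1/2))
  have h := DFunLike.congr_fun hx 0
  simp at h
  have h2 : (2 * x 0 : ℚ) = 1 := by rw [h]; norm_num
  have h3 : 2 * x 0 = 1 := by exact_mod_cast h2
  omega

/-- torsion-kernel counting -/
theorem card_fin {A B : Type*} [AddCommGroup A] [AddCommGroup B] [Finite A] (f : A →+ B)
    (hf : Function.Surjective f) (n : ℕ) :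
    Nat.card (nsmulAddMonoidHom n : B →+ B).ker ≤ Nat.card (nsmulAddMonoidHom n : A →+ A).ker := by
  have : Finite B := Finite.of_surjective f hf
  have key : ∀ (C : Type _) [AddCommGroup C] [Finite C], 
    Nat.card (nsmulAddMonoidHom n : C →+ C).ker = (nsmulAddMonoidHom n : C →+ C).range.index := by
    intro C _ _
    have h1 := (nsmulAddMonoidHom n : C →+ C).range.card_mul_index
    have h2 := (nsmulAddMonoidHom n : C →+ C).ker.card_mul_index
    rw [AddSubgroup.index_ker] at h2
    have h3 : 0 < Nat.card (nsmulAddMonoidHom n : C →+ C).range := Nat.card_pos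
    apply Nat.eq_of_mul_eq_mul_left h3
    rw [h1, ← h2, mul_comm]
  have keyB : Nat.card (nsmulAddMonoidHom n : B →+ B).ker = (nsmulAddMonoidHom n : B →+ B).range.index := by
    have h1 := (nsmulAddMonoidHom n : B →+ B).range.card_mul_index
    have h2 := (nsmulAddMonoidHom n : B →+ B).ker.card_mul_index
    rw [AddSubgroup.index_ker] at h2
    have h3 : 0 < Nat.card (nsmulAddMonoidHom n : B →+ B).range := Nat.card_pos
    apply Nat.eq_of_mul_eq_mul_left h3
    rw [h1, ← h2, mul_comm]
  rw [key A, keyB]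
  have h4 : (nsmulAddMonoidHom n : B →+ B).range = (nsmulAddMonoidHom n : A →+ A).range.map f := by
    ext b
    constructor
    · rintro ⟨b, rfl⟩
      obtain ⟨a, rfl⟩ := hf b
      exact ⟨n • a, ⟨a, rfl⟩, by simp⟩
    · rintro ⟨_, ⟨a, rfl⟩, rfl⟩
      exact ⟨f a, by simp⟩
  rw [h4]
  apply Nat.le_of_dvd (Nat.pos_of_ne_zero AddSubgroup.index_ne_zero_of_finite)
  exact AddSubgroup.index_map_dvd _ hf

/-- `n`-torsion of a quotient by a torsion subgroup. -/
theorem tor_quot {A B : Type*} [AddCommGroup A] [AddCommGroup B] (f : A →+ B)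
    (hf : Function.Surjective f) (hk : ∀ x, f x = 0 → ∃ m : ℕ, 0 < m ∧ m • x = 0) (n : ℕ)
    (hn : 0 < n) (hA : Finite (nsmulAddMonoidHom n : A →+ A).ker) :
    Finite (nsmulAddMonoidHom n : B →+ B).ker ∧ 
    Nat.card (nsmulAddMonoidHom n : B →+ B).ker ≤ Nat.card (nsmulAddMonoidHom n : A →+ A).ker := by
  classical
  have main : ∀ s : Finset (nsmulAddMonoidHom n : B →+ B).ker,
      s.card ≤ Nat.card (nsmulAddMonoidHom n : A →+ A).ker := by
    intro s
    choose l hl using hf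
    let S : Set A := ((s.image (fun b => l b.1) : Finset A) : Set A)
    let M := AddSubgroup.closure S
    have htor : ∀ x ∈ S, ∃ m : ℕ, 0 < m ∧ m • x = 0 := by
      intro x hx
      simp only [S, Finset.coe_image, Set.mem_image] at hx
      obtain ⟨b, -, rfl⟩ := hx
      obtain ⟨m, hm, h⟩ := hk (n • l b.1) (by rw [map_nsmul, hl]; exact b.2)
      exact ⟨m * n, by positivity, by rw [mul_smul]; exact h⟩
    have hfin : Finite M := by
      have hfg : AddGroup.FG M := (AddGroup.fg_iff_addSubgroup_fg M).mpr ⟨_, rfl⟩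
      have ht : IsAddTorsion M := by
        rintro ⟨x, hx⟩
        rw [isOfFinAddOrder_iff_nsmul_eq_zero]
        suffices ∃ m : ℕ, 0 < m ∧ m • x = 0 by
          obtain ⟨m, hm, h⟩ := this
          exact ⟨m, hm, Subtype.ext h⟩
        induction hx using AddSubgroup.closure_induction with
        | mem x hx => exact htor x hx
        | zero => exact ⟨1, by simp⟩
        | add x y _ _ hx hy =>
          obtain ⟨m, hm, h⟩ := hx
          obtain ⟨m', hm', h'⟩ := hy
          refine ⟨m * m', by positivity, ?_⟩
          rw [smul_add, mul_smul m m' y, h', mul_comm, mul_smul, h]; simp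
        | neg x _ hx =>
          obtain ⟨m, hm, h⟩ := hx
          exact ⟨m, hm, by simp [h]⟩
      exact AddCommGroup.finite_of_fg_isAddTorsion M ht
    let f' : M →+ (M.map f) := f.addSubgroupMap M
    have hle := card_fin f' (f.addSubgroupMap_surjective M) n
    have : Finite (M.map f) := Finite.of_surjective f' (f.addSubgroupMap_surjective M)
    have h1 : s.card ≤ Nat.card (nsmulAddMonoidHom n : (M.map f) →+ (M.map f)).ker := by
      rw [← Nat.card_eq_finsetCard]
      let g : s → (nsmulAddMonoidHom n : (M.map f) →+ (M.map f)).ker := fun b =>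
        ⟨⟨b.1.1, ⟨l b.1.1, AddSubgroup.subset_closure (by simp only [S, Finset.coe_image]; exact ⟨b.1, b.2, rfl⟩), hl _⟩⟩, 
          Subtype.ext b.1.2⟩
      apply Nat.card_le_card_of_injective g
      intro a b h
      have := congrArg (fun z => (z.1.1 : B)) h
      exact Subtype.ext (Subtype.ext this)
    have h2 : Nat.card (nsmulAddMonoidHom n : M →+ M).ker ≤ Nat.card (nsmulAddMonoidHom n : A →+ A).ker := by
      let g : (nsmulAddMonoidHom n : M →+ M).ker → (nsmulAddMonoidHom n : A →+ A).ker := fun b =>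
        ⟨b.1.1, congrArg Subtype.val b.2⟩
      apply Nat.card_le_card_of_injective g
      intro a b h
      have := congrArg (fun z => (z.1 : A)) h
      exact Subtype.ext (Subtype.ext this)
    exact h1.trans (hle.trans h2)
  have hfin : Finite (nsmulAddMonoidHom n : B →+ B).ker := by
    by_contra hcon
    rw [not_finite_iff_infinite] at hcon
    obtain ⟨s, hs⟩ := Infinite.exists_subset_card_eq (nsmulAddMonoidHom n : B →+ B).ker (Nat.card (nsmulAddMonoidHom n : A →+ A).ker + 1)
    have := main s
    omega
  refine ⟨hfin, ?_⟩
  have := Fintype.ofFinite (nsmulAddMonoidHom n : B →+ B).ker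
  have := main Finset.univ
  rwa [Finset.card_univ, ← Nat.card_eq_fintype_card] at this

structure Good (G : Type*) [AddCommGroup G] : Prop where
  rank : Module.rank ℤ G < Cardinal.aleph0
  tor : ∀ n : ℕ, 0 < n → Finite (nsmulAddMonoidHom n : G →+ G).ker
  div : ∀ n : ℕ, 0 < n → ∀ g : G, ∃ h t : G, g = n • h + t ∧ ∃ m : ℕ, 0 < m ∧ m • t = 0

theorem tors_of_rank {M : Type*} [AddCommGroup M] (h : Module.rank ℤ M = 0) (x : M) :
    ∃ m : ℕ, 0 < m ∧ m • x = 0 := by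
  obtain ⟨a, ha, hx⟩ := rank_eq_zero_iff.mp h x
  refine ⟨a.natAbs, Int.natAbs_pos.mpr ha, ?_⟩
  rcases Int.natAbs_eq a with h' | h'
  · rw [h'] at hx; simpa only [natCast_zsmul] using hx
  · rw [h'] at hx; simpa only [neg_smul, neg_eq_zero, natCast_zsmul] using hx

theorem good_cob {G : Type*} [AddCommGroup G] (hG : Good G) : IsCoBassian G := by
  intro N φ hφ
  let q := (QuotientAddGroup.mk' N)
  have hq : Function.Surjective q := QuotientAddGroup.mk'_surjective N
  have hqs : Function.Surjective q.toIntLinearMap := hq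
  have r1 := LinearMap.rank_range_add_rank_ker q.toIntLinearMap
  rw [rank_range_of_surjective _ hqs] at r1
  have r2 : Module.rank ℤ (LinearMap.range φ.toIntLinearMap) = Module.rank ℤ G :=
    (LinearEquiv.ofInjective φ.toIntLinearMap hφ).rank_eq.symm
  have r3 := Submodule.rank_quotient_add_rank (LinearMap.range φ.toIntLinearMap)
  rw [r2] at r3
  have hfin := hG.rank
  have le1 : Module.rank ℤ (G ⧸ N) ≤ Module.rank ℤ G := by rw [← r1]; exact self_le_add_right _ _
  have le2 : Module.rank ℤ G ≤ Module.rank ℤ (G ⧸ N) := by rw [← r3]; exact self_le_add_left _ _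
  have heq := le_antisymm le1 le2
  have k1 : Module.rank ℤ (LinearMap.ker q.toIntLinearMap) = 0 := by
    rw [heq] at r1
    exact Cardinal.eq_of_add_eq_add_left (a := Module.rank ℤ G) (by rw [r1, add_zero]) hfin
  have k2 : Module.rank ℤ ((G ⧸ N) ⧸ LinearMap.range φ.toIntLinearMap) = 0 := by
    rw [heq] at r3
    exact Cardinal.eq_of_add_eq_add_right (b := Module.rank ℤ G) (by rw [r3, zero_add]) hfin
  have hker : ∀ x, q x = 0 → ∃ m : ℕ, 0 < m ∧ m • x = 0 := by
    intro x hx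
    obtain ⟨m, hm, h⟩ := tors_of_rank k1 ⟨x, hx⟩
    exact ⟨m, hm, congrArg Subtype.val h⟩
  have htor : ∀ (n : ℕ), 0 < n → ∀ y : G ⧸ N, n • y = 0 → ∃ x, φ x = y := by
    intro n hn y hy
    have hA := hG.tor n hn
    obtain ⟨hB, hle⟩ := tor_quot q hq hker n hn hA
    let g : (nsmulAddMonoidHom n : G →+ G).ker → (nsmulAddMonoidHom n : (G ⧸ N) →+ (G ⧸ N)).ker :=
      fun x => ⟨φ x.1, by
        have := x.2
        rw [AddMonoidHom.mem_ker] at this ⊢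
        simp only [nsmulAddMonoidHom_apply] at this ⊢
        rw [← map_nsmul, this, map_zero]⟩
    have gi : Function.Injective g := by
      intro a b h
      exact Subtype.ext (hφ (congrArg Subtype.val h))
    have gb : Function.Bijective g := by
      have := Fintype.ofFinite (nsmulAddMonoidHom n : G →+ G).ker
      have := Fintype.ofFinite (nsmulAddMonoidHom n : (G ⧸ N) →+ (G ⧸ N)).ker
      rw [Fintype.bijective_iff_injective_and_card]
      refine ⟨gi, ?_⟩
      rw [← Nat.card_eq_fintype_card, ← Nat.card_eq_fintype_card]
      exact le_antisymm (Nat.card_le_card_of_injective g gi) hle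
    obtain ⟨x, hx⟩ := gb.2 ⟨y, hy⟩
    exact ⟨x.1, congrArg Subtype.val hx⟩
  intro h
  obtain ⟨n, hn, h1⟩ := tors_of_rank k2 (Submodule.Quotient.mk h)
  rw [← Submodule.Quotient.mk_smul, Submodule.Quotient.mk_eq_zero] at h1
  obtain ⟨x, hx⟩ := h1
  have hx : φ x = n • h := hx
  obtain ⟨y, t, rfl, m, hm, ht⟩ := hG.div n hn x
  obtain ⟨z, hz⟩ := htor (m * n) (by positivity) (h - φ y) (by
    rw [mul_smul, smul_sub, ← hx, map_add, map_nsmul, add_sub_cancel_left, ← map_nsmul, ht, map_zero])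
  exact ⟨z + y, by rw [map_add, hz]; abel⟩

theorem good_quot {G : Type*} [AddCommGroup G] (hG : Good G) (K : AddSubgroup G) :
    Good (G ⧸ K) := by
  have hq : Function.Surjective (QuotientAddGroup.mk' K) := QuotientAddGroup.mk'_surjective K
  have hqs : Function.Surjective (QuotientAddGroup.mk' K).toIntLinearMap := hq
  refine ⟨(LinearMap.rank_le_of_surjective _ hqs).trans_lt hG.rank, ?_, ?_⟩
  · intro n hn
    obtain ⟨s, hs, hli⟩ := exists_set_linearIndependent_of_isDomain ℤ (AddSubgroup.toIntSubmodule K)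
    have hKr : Module.rank ℤ (AddSubgroup.toIntSubmodule K) < Cardinal.aleph0 :=
      (Submodule.rank_le _).trans_lt hG.rank
    have hsf : s.Finite := by
      rw [← Cardinal.lt_aleph0_iff_set_finite, hs]; exact hKr
    have r1 := Submodule.rank_quotient_add_rank (Submodule.span ℤ s)
    rw [rank_span_set hli, hs] at r1
    have k1 : Module.rank ℤ (AddSubgroup.toIntSubmodule K ⧸ Submodule.span ℤ s) = 0 :=
      Cardinal.eq_of_add_eq_add_right (b := Module.rank ℤ (AddSubgroup.toIntSubmodule K)) (by rw [r1, zero_add]) hKr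
    let F : Submodule ℤ G := (Submodule.span ℤ s).map (AddSubgroup.toIntSubmodule K).subtype
    have hFfg : F.FG := (Submodule.fg_span hsf).map _
    let F' : AddSubgroup G := F.toAddSubgroup
    have hFK : F' ≤ K := by
      rintro _ ⟨x, -, rfl⟩
      exact x.2
    have hFK2 : ∀ x ∈ K, ∃ m : ℕ, 0 < m ∧ m • x ∈ F' := by
      intro x hx
      obtain ⟨m, hm, h⟩ := tors_of_rank k1 (Submodule.Quotient.mk ⟨x, hx⟩)
      rw [← Submodule.Quotient.mk_smul, Submodule.Quotient.mk_eq_zero] at h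
      exact ⟨m, hm, _, h, rfl⟩
    have hF'fg : AddGroup.FG F' := by
      rw [AddGroup.fg_iff_addSubgroup_fg, ← Submodule.fg_iff_addSubgroup_fg]
      exact hFfg
    let R := (nsmulAddMonoidHom n : F' →+ F').range
    have hfinR : Finite (F' ⧸ R) := by
      have : IsAddTorsion (F' ⧸ R) := by
        intro x
        rw [isOfFinAddOrder_iff_nsmul_eq_zero]
        obtain ⟨x, rfl⟩ := QuotientAddGroup.mk'_surjective _ x
        refine ⟨n, hn, ?_⟩
        rw [← map_nsmul]
        exact (QuotientAddGroup.eq_zero_iff (N := R) _).mpr ⟨x, rfl⟩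
      exact AddCommGroup.finite_of_fg_isAddTorsion _ this
    have hFtor : Finite (nsmulAddMonoidHom n : (G ⧸ F') →+ (G ⧸ F')).ker := by
      have hl : ∀ a : (nsmulAddMonoidHom n : (G ⧸ F') →+ (G ⧸ F')).ker,
          ∃ g : G, QuotientAddGroup.mk' F' g = a.1 ∧ n • g ∈ F' := by
        intro a
        obtain ⟨g, hg⟩ := QuotientAddGroup.mk'_surjective F' a.1
        refine ⟨g, hg, ?_⟩
        apply (QuotientAddGroup.eq_zero_iff (N := F') _).mp
        show QuotientAddGroup.mk' F' (n • g) = 0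
        rw [map_nsmul, hg]
        exact a.2
      choose l hl1 hl2 using hl
      let c : (nsmulAddMonoidHom n : (G ⧸ F') →+ (G ⧸ F')).ker → F' ⧸ R :=
        fun a => QuotientAddGroup.mk' R ⟨n • l a, hl2 a⟩
      rw [← Set.finite_univ_iff]
      apply Set.Finite.of_finite_fibers c (Set.toFinite _)
      rintro _ ⟨a, -, rfl⟩
      have hT := hG.tor n hn
      have hfi : (Set.range (fun t : (nsmulAddMonoidHom n : G →+ G).ker =>
        QuotientAddGroup.mk' F' t.1 + a.1)).Finite := Set.finite_range _
      refine Set.Finite.subset (hfi.preimage (f := Subtype.val) Subtype.val_injective.injOn) ?_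
      rintro b ⟨-, hb⟩
      have hb : QuotientAddGroup.mk' R ⟨n • l b, hl2 b⟩ = QuotientAddGroup.mk' R ⟨n • l a, hl2 a⟩ := hb
      rw [← sub_eq_zero, ← map_sub] at hb
      obtain ⟨f, hf⟩ := (QuotientAddGroup.eq_zero_iff (N := R) _).mp hb
      have hf' : n • (f : G) = n • l b - n • l a := congrArg Subtype.val hf
      refine ⟨⟨l b - l a - f, ?_⟩, ?_⟩
      · show n • (l b - l a - (f : G)) = 0
        rw [smul_sub, smul_sub, hf', sub_self]
      · show QuotientAddGroup.mk' F' (l b - l a - f) + a.1 = b.1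
        rw [map_sub, map_sub, hl1, hl1, show QuotientAddGroup.mk' F' (f : G) = 0 from
          (QuotientAddGroup.eq_zero_iff (N := F') _).mpr f.2]
        abel
    refine (tor_quot (QuotientAddGroup.map F' K (AddMonoidHom.id G) hFK) ?_ ?_ n hn hFtor).1
    · intro x
      obtain ⟨x, rfl⟩ := hq x
      exact ⟨QuotientAddGroup.mk x, rfl⟩
    · intro x hx
      obtain ⟨x, rfl⟩ := QuotientAddGroup.mk'_surjective _ x
      have hx : x ∈ K := (QuotientAddGroup.eq_zero_iff (N := K) x).mp hx
      obtain ⟨m, hm, h⟩ := hFK2 x hx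
      refine ⟨m, hm, ?_⟩
      rw [← map_nsmul]
      exact (QuotientAddGroup.eq_zero_iff (N := F') _).mpr h
  · intro n hn g
    obtain ⟨g, rfl⟩ := hq g
    obtain ⟨h, t, rfl, m, hm, ht⟩ := hG.div n hn g
    refine ⟨QuotientAddGroup.mk' K h, QuotientAddGroup.mk' K t, by rw [map_add, map_nsmul], m, hm, ?_⟩
    rw [← map_nsmul, ht, map_zero]

theorem retr_surj {G : Type*} [AddCommGroup G] (hG : IsCoBassian G) {F : Type*} [AddCommGroup F]
    (i : F →+ G) (r : G →+ F) (hri : ∀ x, r (i x) = x) (s : F →+ F) (hs : Function.Injective s) :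
    Function.Surjective s := by
  let φ : G →+ G := AddMonoidHom.id G - i.comp r + i.comp (s.comp r)
  have hφ : ∀ g, φ g = g - i (r g) + i (s (r g)) := fun g => rfl
  have hr : ∀ g, r (φ g) = s (r g) := by
    intro g; rw [hφ, map_add, map_sub, hri, hri]; abel
  have := crit hG (AddMonoidHom.id G) φ Function.surjective_id (by
    rw [injective_iff_map_eq_zero]
    intro g hg
    have h1 := hr g
    rw [hg, map_zero] at h1
    have h2 : r g = 0 := (injective_iff_map_eq_zero s).mp hs _ h1.symm
    rw [hφ, h2] at hg
    simpa using hg)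
  intro y
  obtain ⟨g, hg⟩ := this (i y)
  exact ⟨r g, by rw [← hr, hg, hri]⟩

theorem retr_ker {G : Type*} [AddCommGroup G] (hG : IsCoBassian G) {F : Type*} [AddCommGroup F]
    (i : F →+ G) (r : G →+ F) (hri : ∀ x, r (i x) = x) : IsCoBassian r.ker := by
  intro N φ hφ
  let π : G →+ r.ker := (AddMonoidHom.id G - i.comp r).codRestrict r.ker (by
    intro g
    rw [AddMonoidHom.mem_ker]
    show r (g - i (r g)) = 0
    rw [map_sub, hri, sub_self])
  have hπ : ∀ g, (π g : G) = g - i (r g) := fun g => rfl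
  have hπ1 : ∀ x : r.ker, π x.1 = x := by
    intro x
    apply Subtype.ext
    rw [hπ, show r x.1 = 0 from x.2, map_zero, sub_zero]
  have hπ2 : ∀ y, π (i y) = 0 := by
    intro y
    apply Subtype.ext
    rw [hπ, hri]; simp
  have := crit hG (((QuotientAddGroup.mk' N).comp π).prod r) ((φ.comp π).prod r) (by
    rintro ⟨a, b⟩
    obtain ⟨a, rfl⟩ := QuotientAddGroup.mk'_surjective _ a
    refine ⟨a.1 + i b, Prod.ext ?_ ?_⟩
    · show QuotientAddGroup.mk' N (π (a.1 + i b)) = _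
      rw [map_add, hπ1, hπ2, add_zero]
    · show r (a.1 + i b) = b
      rw [map_add, hri, show r a.1 = 0 from a.2, zero_add]) (by
    rw [injective_iff_map_eq_zero]
    intro g hg
    have h1 : φ (π g) = 0 := congrArg Prod.fst hg
    have h2 : r g = 0 := congrArg Prod.snd hg
    have h3 := (injective_iff_map_eq_zero φ).mp hφ _ h1
    have h4 := hπ g
    rw [h3, h2] at h4
    simpa using h4.symm)
  intro y
  obtain ⟨g, hg⟩ := this (y, 0)
  exact ⟨π g, congrArg Prod.fst hg⟩

theorem liftZ {ι G : Type*} [AddCommGroup G] (m : ℕ) (x : ι → G) (hx : ∀ j, m • x j = 0) :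
    ∃ i : (ι →₀ ZMod m) →+ G, ∀ a : ι →₀ ℤ,
      i (Finsupp.mapRange.addMonoidHom (Int.castAddHom (ZMod m)) a) =
        Finsupp.linearCombination ℤ x a := by
  classical
  refine ⟨Finsupp.liftAddHom (fun j => ZMod.lift m ⟨zmultiplesHom G (x j), by simpa using hx j⟩), ?_⟩
  intro a
  induction a using Finsupp.induction_linear with
  | zero => simp
  | add a b ha hb => rw [map_add, map_add, ha, hb, map_add]
  | single j z => simp

theorem castSurj (ι : Type*) (m : ℕ) : Function.Surjective
    (Finsupp.mapRange.addMonoidHom (ι := ι) (Int.castAddHom (ZMod m))) := by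
  apply Finsupp.mapRange_surjective
  · simp
  · exact ZMod.intCast_surjective

theorem cast_zero_iff {ι : Type*} {m : ℕ} (a : ι →₀ ℤ) :
    (Finsupp.mapRange.addMonoidHom (ι := ι) (Int.castAddHom (ZMod m))) a = 0 ↔ ∀ j, (m : ℤ) ∣ a j := by
  rw [Finsupp.ext_iff]
  apply forall_congr'
  intro j
  simp [ZMod.intCast_zmod_eq_zero_iff_dvd]

theorem div_out {ι : Type*} {m : ℤ} (_hm : m ≠ 0) (a : ι →₀ ℤ) (h : ∀ j, m ∣ a j) :
    ∃ a' : ι →₀ ℤ, a = m • a' := by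
  refine ⟨a.mapRange (fun z => z / m) (by simp), ?_⟩
  ext j
  simp [Int.mul_ediv_cancel' (h j)]

theorem cop_mem {G : Type*} [AddCommGroup G] {p : ℕ} (hp : p.Prime) {z : ℤ} (hz : ¬ (p : ℤ) ∣ z)
    (C : AddSubgroup G) (g : G) (h1 : (p : ℤ) • g ∈ C) (h2 : z • g ∈ C) : g ∈ C := by
  have hc : IsCoprime (p : ℤ) z := (Nat.prime_iff_prime_int.mp hp).coprime_iff_not_dvd.mpr hz
  obtain ⟨u, v, huv⟩ := hc
  have : g = u • ((p : ℤ) • g) + v • (z • g) := by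
    rw [← mul_smul, ← mul_smul, ← add_smul, huv, one_smul]
  rw [this]
  exact C.add_mem (C.zsmul_mem h1 _) (C.zsmul_mem h2 _)

theorem lemmaZ {ι G : Type*} [AddCommGroup G] {p : ℕ} (hp : p.Prime) (n : ℕ) (x : ι → G)
    (hx : ∀ j, p ^ (n + 1) • x j = 0)
    (hind : ∀ (a : ι →₀ ℤ) (g : G),
      p ^ n • Finsupp.linearCombination ℤ x a = p ^ (n + 1) • g → ∀ j, (p : ℤ) ∣ a j) :
    ∃ (i : (ι →₀ ZMod (p ^ (n + 1))) →+ G) (r : G →+ (ι →₀ ZMod (p ^ (n + 1)))),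
      (∀ z, r (i z) = z) ∧ ∀ a : ι →₀ ℤ,
      i (Finsupp.mapRange.addMonoidHom (Int.castAddHom (ZMod (p ^ (n + 1)))) a) =
        Finsupp.linearCombination ℤ x a := by
  classical
  obtain ⟨i, hi⟩ := liftZ (p ^ (n + 1)) x hx
  set ψ := Finsupp.linearCombination ℤ x with hψ
  have hpz : (p : ℤ) ≠ 0 := by exact_mod_cast hp.ne_zero
  have hψ0 : ∀ a, p ^ (n + 1) • ψ a = 0 := by
    intro a
    rw [← map_nsmul]
    induction a using Finsupp.induction_linear with
    | zero => simp
    | add a b ha hb => rw [smul_add, map_add, ha, hb, add_zero]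
    | single j z => 
      rw [map_nsmul, hψ, Finsupp.linearCombination_single, smul_comm, hx, smul_zero]
  let V : Submodule ℤ G := LinearMap.range ((p ^ n) • ψ)
  let C0 : Submodule ℤ G := LinearMap.range ((p ^ (n + 1)) • (LinearMap.id : G →ₗ[ℤ] G))
  have hV : ∀ v, v ∈ V ↔ ∃ a, p ^ n • ψ a = v := fun v => Iff.rfl
  have h0 : Disjoint V C0 := by
    rw [Submodule.disjoint_def]
    rintro v ⟨a, ha⟩ ⟨g, hg⟩
    have ha : p ^ n • ψ a = v := ha
    have hg : p ^ (n + 1) • g = v := hg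
    obtain ⟨a', rfl⟩ := div_out hpz a (hind a g (ha.trans hg.symm))
    rw [← ha, map_zsmul, natCast_zsmul, ← mul_smul, ← pow_succ, hψ0]
  obtain ⟨C, hC0, hC⟩ := zorn_le_nonempty₀ {C : Submodule ℤ G | Disjoint V C} (by
    intro c hc hchain y hy
    refine ⟨sSup c, ?_, fun z hz => le_sSup hz⟩
    show Disjoint V (sSup c)
    rw [hchain.directedOn.disjoint_sSup_right]
    intro b hb
    exact hc hb) C0 h0
  have hdis : Disjoint V C := hC.prop
  rw [Submodule.disjoint_def] at hdis
  have hsoc : ∀ g, p • g ∈ C → ∃ a, g - p ^ n • ψ a ∈ C := by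
    intro g hg
    by_cases hgC : g ∈ C
    · exact ⟨0, by simpa using hgC⟩
    have hnd : ¬ Disjoint V (C ⊔ Submodule.span ℤ {g}) := by
      intro hd
      apply hgC
      exact hC.le_of_ge hd le_sup_left (Submodule.mem_sup_right (Submodule.mem_span_singleton_self g))
    rw [Submodule.disjoint_def] at hnd
    push Not at hnd
    obtain ⟨v, hvV, hv, hv0⟩ := hnd
    obtain ⟨c, hc, w, hw, rfl⟩ := Submodule.mem_sup.mp hv
    obtain ⟨k, rfl⟩ := Submodule.mem_span_singleton.mp hw
    have hk : ¬ (p : ℤ) ∣ k := by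
      rintro ⟨k', rfl⟩
      apply hv0
      apply hdis _ hvV
      refine C.add_mem hc ?_
      rw [mul_comm, mul_smul, natCast_zsmul]
      exact C.smul_mem _ hg
    have := cop_mem hp hk (V ⊔ C).toAddSubgroup g
      (by rw [natCast_zsmul]; exact Submodule.mem_sup_right hg)
      (by
        have : k • g = (c + k • g) - c := by abel
        rw [this]
        exact (V ⊔ C).sub_mem (Submodule.mem_sup_left hvV) (Submodule.mem_sup_right hc))
    obtain ⟨_, ⟨a, rfl⟩, c', hc', h⟩ := Submodule.mem_sup.mp this
    refine ⟨a, ?_⟩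
    rw [← h]
    have : ((p ^ n) • ψ) a + c' - p ^ n • ψ a = c' := by
      rw [LinearMap.smul_apply]; abel
    rwa [this]
  have hinj : ∀ a, ψ a ∈ C → ∀ k, k ≤ n + 1 → ∀ j, ((p ^ k : ℕ) : ℤ) ∣ a j := by
    intro a ha k
    induction k with
    | zero => simp
    | succ k ih =>
      intro hk
      obtain ⟨a', rfl⟩ := div_out (by exact_mod_cast (pow_pos hp.pos k).ne') a (ih (by omega))
      have h1 : p ^ n • ψ a' ∈ C := by
        have : p ^ n • ψ a' = p ^ (n - k) • ψ (((p ^ k : ℕ) : ℤ) • a') := by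
          rw [map_zsmul, natCast_zsmul, ← mul_smul, ← pow_add, Nat.sub_add_cancel (by omega)]
        rw [this]
        exact C.smul_of_tower_mem _ ha
      have h2 := hdis _ ⟨a', rfl⟩ h1
      have h3 := hind a' 0 (by rw [smul_zero]; exact h2)
      intro j
      rw [Finsupp.smul_apply, smul_eq_mul, pow_succ]
      push_cast
      exact mul_dvd_mul_left _ (h3 j)
  have hsurj : ∀ k, k ≤ n + 1 → ∀ g, p ^ k • g ∈ C → ∃ a, g - ψ a ∈ C := by
    intro k
    induction k with
    | zero => intro _ g hg; exact ⟨0, by simpa using hg⟩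
    | succ k ih =>
      intro hk g hg
      obtain ⟨a, ha⟩ := hsoc (p ^ k • g) (by rwa [← mul_smul, ← pow_succ'])
      obtain ⟨a', ha'⟩ := ih (by omega) (g - ψ (p ^ (n - k) • a)) (by
        rw [map_nsmul, smul_sub, ← mul_smul, ← pow_add, Nat.add_sub_cancel' (by omega)]
        exact ha)
      refine ⟨p ^ (n - k) • a + a', ?_⟩
      rw [map_add, ← sub_sub]
      exact ha'
  let q : G →+ G ⧸ C.toAddSubgroup := QuotientAddGroup.mk' C.toAddSubgroup
  have hq0 : ∀ g, q g = 0 ↔ g ∈ C := fun g => QuotientAddGroup.eq_zero_iff (N := C.toAddSubgroup) g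
  have hbij : Function.Bijective (q.comp i) := by
    constructor
    · rw [injective_iff_map_eq_zero]
      intro z hz
      obtain ⟨a, rfl⟩ := castSurj ι _ z
      rw [AddMonoidHom.comp_apply, hi, hq0] at hz
      rw [cast_zero_iff]
      exact hinj a hz _ le_rfl
    · intro y
      obtain ⟨g, rfl⟩ := QuotientAddGroup.mk'_surjective _ y
      obtain ⟨a, ha⟩ := hsurj (n + 1) le_rfl g (hC0 ⟨g, rfl⟩)
      refine ⟨Finsupp.mapRange.addMonoidHom (Int.castAddHom (ZMod (p ^ (n + 1)))) a, ?_⟩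
      rw [AddMonoidHom.comp_apply, hi]
      rw [← hq0, map_sub, sub_eq_zero] at ha
      exact ha.symm
  let e := AddEquiv.ofBijective (q.comp i) hbij
  refine ⟨i, e.symm.toAddMonoidHom.comp q, ?_, hi⟩
  intro z
  exact e.symm_apply_apply z

theorem selSeq {G : Type*} [AddCommGroup G] {p : ℕ} (hp : p.Prime) (S : ℕ → AddSubgroup G)
    (hS : ∀ n, Infinite (S n)) (hSp : ∀ n, ∀ x ∈ S n, p • x = 0) (W : AddSubgroup G)
    (hW : Finite W) :
    ∃ b : ℕ → G, (∀ n, b n ∈ S n) ∧ ∀ a : ℕ →₀ ℤ, Finsupp.linearCombination ℤ b a ∈ W →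
      ∀ j, (p : ℤ) ∣ a j := by
  classical
  have step : ∀ (n : ℕ) (U : {U : AddSubgroup G // Finite U}), ∃ b ∈ S n, b ∉ U.1 := by
    intro n U
    by_contra hcon
    push Not at hcon
    have := U.2
    have hle : S n ≤ U.1 := hcon
    have : Finite (S n) := Finite.of_injective _ (AddSubgroup.inclusion_injective hle)
    exact not_finite (S n)
  choose f hfS hfU using step
  have hfin : ∀ n (U : {U : AddSubgroup G // Finite U}), 
      Finite (U.1 ⊔ AddSubgroup.zmultiples (f n U) : AddSubgroup G) := by
    intro n U
    have h1 := U.2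
    have h2 : Finite (AddSubgroup.zmultiples (f n U)) := by
      refine Set.Finite.to_subtype (finite_zmultiples.mpr ?_)
      rw [isOfFinAddOrder_iff_nsmul_eq_zero]
      exact ⟨p, hp.pos, hSp n _ (hfS n U)⟩
    let g : U.1 × AddSubgroup.zmultiples (f n U) → 
      (U.1 ⊔ AddSubgroup.zmultiples (f n U) : AddSubgroup G) := fun y =>
        ⟨y.1.1 + y.2.1, AddSubgroup.add_mem_sup y.1.2 y.2.2⟩
    apply Finite.of_surjective g
    rintro ⟨x, hx⟩
    obtain ⟨y, hy, z, hz, rfl⟩ := AddSubgroup.mem_sup.mp hx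
    exact ⟨(⟨y, hy⟩, ⟨z, hz⟩), rfl⟩
  let st : ℕ → {U : AddSubgroup G // Finite U} := fun n =>
    Nat.rec ⟨W, hW⟩ (fun n U => ⟨U.1 ⊔ AddSubgroup.zmultiples (f n U), hfin n U⟩) n
  have st0 : (st 0).1 = W := rfl
  have stS : ∀ n, (st (n + 1)).1 = (st n).1 ⊔ AddSubgroup.zmultiples (f n (st n)) := fun n => rfl
  have hmono : Monotone (fun n => (st n).1) := by
    apply monotone_nat_of_le_succ
    intro n
    rw [stS]
    exact le_sup_left
  let b : ℕ → G := fun n => f n (st n)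
  have hb : ∀ k N, k < N → b k ∈ (st N).1 := by
    intro k N h
    apply hmono (Nat.succ_le_of_lt h)
    show b k ∈ (st (k + 1)).1
    rw [stS]
    exact (le_sup_right : _ ≤ (st k).1 ⊔ AddSubgroup.zmultiples (f k (st k))) (AddSubgroup.mem_zmultiples _)
  have hpb : ∀ n, p • b n = 0 := fun n => hSp n _ (hfS n _)
  refine ⟨b, fun n => hfS n _, ?_⟩
  have main : ∀ N, ∀ a : ℕ →₀ ℤ, (∀ k, N ≤ k → (p : ℤ) ∣ a k) →
      Finsupp.linearCombination ℤ b a ∈ W → ∀ j, (p : ℤ) ∣ a j := by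
    intro N
    induction N with
    | zero => intro a h _ j; exact h j (Nat.zero_le _)
    | succ N ih =>
      intro a h ha
      apply ih a _ ha
      intro k hk
      rcases Nat.lt_or_ge N k with h' | h'
      · exact h k h'
      obtain rfl : k = N := le_antisymm h' hk
      by_contra hnd
      apply hfU k (st k)
      apply cop_mem hp hnd
      · rw [natCast_zsmul]
        have := hpb k
        rw [show p • f k (st k) = 0 from this]
        exact zero_mem _
      · have h1 : Finsupp.linearCombination ℤ b a = a k • b k + (a.erase k).sum (fun i z => z • b i) := by
          rw [Finsupp.linearCombination_apply]
          exact (Finsupp.add_sum_erase' a k (fun i z => z • b i) (by simp)).symm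
        have h2 : (a.erase k).sum (fun i z => z • b i) ∈ (st k).1 := by
          apply AddSubgroup.sum_mem
          intro j hj
          have hjk : j ≠ k := by
            rintro rfl
            simp at hj
          rcases lt_or_gt_of_ne hjk with hlt | hgt
          · exact AddSubgroup.zsmul_mem _ (hb j k hlt) _
          · rw [Finsupp.erase_ne hjk]
            obtain ⟨c, hc⟩ := h j hgt
            show a j • b j ∈ _
            rw [hc, mul_comm, mul_smul, natCast_zsmul, hpb, smul_zero]
            exact zero_mem _
        have h3 : a k • f k (st k) = Finsupp.linearCombination ℤ b a - (a.erase k).sum (fun i z => z • b i) := by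
          rw [h1]
          show a k • b k = _
          abel
        rw [h3]
        exact AddSubgroup.sub_mem _ (hmono (Nat.zero_le k) ha) h2
  intro a ha
  obtain ⟨N, hN⟩ := a.support.bddAbove
  apply main (N + 1) a _ ha
  intro k hk
  have : a k = 0 := by
    by_contra h
    have := hN (Finset.mem_coe.mpr (Finsupp.mem_support_iff.mpr h))
    omega
  rw [this]; exact dvd_zero _

theorem prufer {p : ℕ} (hp : p.Prime) : ∃ (P : Type) (_ : AddCommGroup P) (c : P),
    (∀ n : ℕ, 0 < n → ∀ d : P, ∃ x : P, n • x = d) ∧ (∀ x : P, ∃ k : ℕ, p ^ k • x = 0) ∧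
    p • c = 0 ∧ c ≠ 0 ∧ ∀ x : P, p • x = 0 → ∃ k : ℤ, x = k • c := by
  haveI : Fact p.Prime := ⟨hp⟩
  have hp0 : (p : ℚ_[p]) ≠ 0 := by exact_mod_cast hp.ne_zero
  have hp1 : (1 : ℝ) < p := by exact_mod_cast hp.one_lt
  let I : AddSubgroup ℚ_[p] := (PadicInt.subring p).toAddSubgroup
  have hI : ∀ x : ℚ_[p], x ∈ I ↔ ‖x‖ ≤ 1 := fun x => Iff.rfl
  let q : ℚ_[p] →+ ℚ_[p] ⧸ I := QuotientAddGroup.mk' I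
  have hq : Function.Surjective q := QuotientAddGroup.mk'_surjective I
  have hq0 : ∀ x, q x = 0 ↔ ‖x‖ ≤ 1 := fun x => QuotientAddGroup.eq_zero_iff (N := I) x
  refine ⟨ℚ_[p] ⧸ I, inferInstance, q ((p : ℚ_[p])⁻¹), ?_, ?_, ?_, ?_, ?_⟩
  · intro n hn d
    obtain ⟨x, rfl⟩ := hq d
    have : (n : ℚ_[p]) ≠ 0 := by exact_mod_cast hn.ne'
    refine ⟨q (x / n), ?_⟩
    rw [← map_nsmul, nsmul_eq_mul]
    congr 1
    field_simp
  · intro x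
    obtain ⟨x, rfl⟩ := hq x
    obtain ⟨k, hk⟩ := pow_unbounded_of_one_lt ‖x‖ hp1
    refine ⟨k, ?_⟩
    rw [← map_nsmul, hq0, nsmul_eq_mul, Nat.cast_pow, norm_mul, norm_pow, Padic.norm_p, inv_pow,
      inv_mul_le_iff₀ (by positivity), mul_one]
    exact hk.le
  · rw [← map_nsmul, hq0, nsmul_eq_mul, mul_inv_cancel₀ hp0]; simp
  · rw [Ne, hq0, norm_inv, Padic.norm_p, inv_inv]
    exact not_le.mpr hp1
  · intro x hx
    obtain ⟨x, rfl⟩ := hq x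
    rw [← map_nsmul, hq0] at hx
    let y : ℤ_[p] := ⟨p • x, hx⟩
    obtain ⟨n, -, hn⟩ := PadicInt.exists_mem_range y
    refine ⟨n, ?_⟩
    rw [← map_zsmul, ← sub_eq_zero, ← map_sub, hq0]
    rw [PadicInt.maximalIdeal_eq_span_p, Ideal.mem_span_singleton] at hn
    obtain ⟨z, hz⟩ := hn
    have hz' : (p • x : ℚ_[p]) - n = p * z := by
      have := congrArg (fun w : ℤ_[p] => (w : ℚ_[p])) hz
      rw [PadicInt.coe_sub, PadicInt.coe_mul] at this
      simpa only [y, PadicInt.coe_natCast] using this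
    have : x - (n : ℤ) • (p : ℚ_[p])⁻¹ = z := by
      rw [nsmul_eq_mul] at hz'
      rw [zsmul_eq_mul]
      push_cast
      field_simp
      linear_combination hz'
    rw [this]
    exact z.2

theorem exists_ne_surj {X : Type*} [AddCommGroup X] [Countable X] {p : ℕ} (hp : p.Prime)
    (hX : ∀ x : X, ∃ k : ℕ, p ^ k • x = 0) {P : Type*} [AddCommGroup P]
    (hP : ∀ n : ℕ, 0 < n → ∀ d : P, ∃ x : P, n • x = d) (c : P) (hpc : p • c = 0) (hc : c ≠ 0) :
    ∃ v : X →+ (ℕ →₀ P), Function.Injective v ∧ ¬ Function.Surjective v := by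
  classical
  haveI : Fact p.Prime := ⟨hp⟩
  let Y := (nsmulAddMonoidHom p : X →+ X).ker
  have hY : ∀ y : Y, p • y = 0 := fun y => Subtype.ext y.2
  letI : Module (ZMod p) Y := AddCommGroup.zmodModule hY
  let B := Module.Basis.ofVectorSpace (ZMod p) Y
  obtain ⟨enc, henc⟩ := Countable.exists_injective_nat (Module.Basis.ofVectorSpaceIndex (ZMod p) Y)
  let en : Module.Basis.ofVectorSpaceIndex (ZMod p) Y → ℕ := fun i => enc i + 1
  have hen : Function.Injective en := fun a b h => henc (Nat.succ_injective h)
  let w1 : Y →+ (ℕ →₀ ZMod p) := 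
    ((Finsupp.lmapDomain (ZMod p) (ZMod p) en).comp B.repr.toLinearMap).toAddMonoidHom
  have hw1 : Function.Injective w1 := (Finsupp.mapDomain_injective hen).comp B.repr.injective
  have hw10 : ∀ y, w1 y 0 = 0 := by
    intro y
    apply Finsupp.mapDomain_of_notMem_range
    rintro ⟨i, hi⟩
    exact Nat.succ_ne_zero _ hi
  let θ0 : ZMod p →+ P := ZMod.lift p ⟨zmultiplesHom P c, by simpa using hpc⟩
  have hθ0 : Function.Injective θ0 := by
    rw [injective_iff_map_eq_zero]
    intro z hz
    obtain ⟨k, rfl⟩ := ZMod.intCast_surjective z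
    have hz : k • c = 0 := by simpa [θ0] using hz
    rw [ZMod.intCast_zmod_eq_zero_iff_dvd]
    by_contra hnd
    exact hc ((AddSubgroup.mem_bot).mp (cop_mem hp hnd ⊥ c (by rw [natCast_zsmul, hpc]; exact zero_mem _) (by rw [hz]; exact zero_mem _)))
  let θ : (ℕ →₀ ZMod p) →+ (ℕ →₀ P) := Finsupp.mapRange.addMonoidHom θ0
  have hθ : Function.Injective θ := Finsupp.mapRange_injective _ (map_zero _) hθ0
  obtain ⟨v, hv⟩ := ext_of_div (finsupp_div hP) Y.subtype Subtype.val_injective (θ.comp w1)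
  have hYv : ∀ x : X, p • x = 0 → ∃ y : Y, x = y := fun x hx => ⟨⟨x, hx⟩, rfl⟩
  have key : ∀ k, ∀ x : X, p ^ k • x = 0 → v x = 0 → x = 0 := by
    intro k
    induction k with
    | zero => intro x hx _; simpa using hx
    | succ k ih =>
      intro x hx hvx
      have h1 := ih (p • x) (by rwa [← mul_smul, ← pow_succ]) (by rw [map_nsmul, hvx, smul_zero])
      obtain ⟨y, rfl⟩ := hYv x h1
      have h2 : θ (w1 y) = 0 := by rw [← hvx]; exact (hv y).symm
      have h3 : y = 0 := hw1 (hθ (by rw [h2, map_zero, map_zero]))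
      rw [h3]; rfl
  have hvi : Function.Injective v := by
    rw [injective_iff_map_eq_zero]
    intro x hx
    obtain ⟨k, hk⟩ := hX x
    exact key k x hk hx
  refine ⟨v, hvi, ?_⟩
  intro hs
  obtain ⟨x, hx⟩ := hs (Finsupp.single 0 c)
  have h1 : p • x = 0 := hvi (by rw [map_nsmul, hx, map_zero, Finsupp.smul_single, hpc, Finsupp.single_zero])
  obtain ⟨y, rfl⟩ := hYv x h1
  have h2 : θ (w1 y) = Finsupp.single 0 c := by rw [← hx]; exact (hv y).symm
  have h3 := DFunLike.congr_fun h2 0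
  have h4 : (θ (w1 y)) 0 = θ0 (w1 y 0) := rfl
  rw [h4, hw10, map_zero, Finsupp.single_eq_same] at h3
  exact hc h3.symm

theorem caseA {G : Type*} [AddCommGroup G] (hG : IsCoBassian G) {p : ℕ} (hp : p.Prime)
    (S : ℕ → AddSubgroup G) (hS : ∀ n x, x ∈ S n ↔ p • x = 0 ∧ ∃ y, p ^ n • y = x)
    (hinf : ∀ n, Infinite (S n)) : False := by
  classical
  obtain ⟨b, hbS, hb⟩ := selSeq hp S hinf (fun n x hx => ((hS n x).mp hx).1) ⊥ inferInstance
  obtain ⟨P, _, c, hdiv, htor, hpc, hc, hsoc⟩ := prufer hp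
  have hpb : ∀ j, p • b j = 0 := fun j => ((hS j _).mp (hbS j)).1
  choose y hy using fun j => ((hS j _).mp (hbS j)).2
  obtain ⟨β, hβ⟩ := liftZ p b hpb
  have hβi : Function.Injective β := by
    rw [injective_iff_map_eq_zero]
    intro z hz
    obtain ⟨a, rfl⟩ := castSurj ℕ _ z
    rw [cast_zero_iff]
    apply hb
    rw [hβ] at hz
    rw [hz]; exact zero_mem _
  let E := ℕ →₀ P
  obtain ⟨u0, hu0⟩ := liftZ (G := E) p (fun j => Finsupp.single (Nat.unpair j).1 c)
    (by intro j; rw [Finsupp.smul_single, hpc, Finsupp.single_zero])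
  obtain ⟨u, hu⟩ := ext_of_div (finsupp_div hdiv) β hβi u0
  have hub : ∀ j, u (b j) = Finsupp.single (Nat.unpair j).1 c := by
    intro j
    have h1 := hβ (Finsupp.single j 1)
    have h2 := hu0 (Finsupp.single j 1)
    rw [Finsupp.linearCombination_single, one_smul] at h1 h2
    rw [← h1, hu, h2]
  let X := AddSubgroup.closure (Set.range y)
  have hXc : Countable X := by
    have hs : Function.Surjective (Finsupp.linearCombination ℤ y).toAddMonoidHom.rangeRestrict :=
      AddMonoidHom.rangeRestrict_surjective _
    have hle : X ≤ (Finsupp.linearCombination ℤ y).toAddMonoidHom.range := by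
      rw [AddSubgroup.closure_le]
      rintro _ ⟨j, rfl⟩
      exact ⟨Finsupp.single j 1, by simp⟩
    have : Countable (Finsupp.linearCombination ℤ y).toAddMonoidHom.range := hs.countable
    exact (AddSubgroup.inclusion_injective hle).countable
  have hXt : ∀ x : X, ∃ k : ℕ, p ^ k • x = 0 := by
    rintro ⟨x, hx⟩
    suffices ∃ k : ℕ, p ^ k • x = 0 by
      obtain ⟨k, hk⟩ := this
      exact ⟨k, Subtype.ext hk⟩
    induction hx using AddSubgroup.closure_induction with
    | mem x hx =>
      obtain ⟨j, rfl⟩ := hx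
      exact ⟨j + 1, by rw [pow_succ', mul_smul, hy, hpb]⟩
    | zero => exact ⟨0, by simp⟩
    | add x y _ _ hx hy =>
      obtain ⟨m, h⟩ := hx
      obtain ⟨m', h'⟩ := hy
      refine ⟨m + m', ?_⟩
      rw [smul_add, pow_add, mul_smul _ _ y, h', mul_comm, mul_smul, h]; simp
    | neg x _ hx =>
      obtain ⟨m, h⟩ := hx
      exact ⟨m, by simp [h]⟩
  have hEt : ∀ e : E, ∃ k : ℕ, p ^ k • e = 0 := by
    intro e
    induction e using Finsupp.induction_linear with
    | zero => exact ⟨0, by simp⟩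
    | add x y hx hy =>
      obtain ⟨m, h⟩ := hx
      obtain ⟨m', h'⟩ := hy
      refine ⟨m + m', ?_⟩
      rw [smul_add, pow_add, mul_smul _ _ y, h', mul_comm, mul_smul, h]; simp
    | single i z =>
      obtain ⟨k, hk⟩ := htor z
      exact ⟨k, by rw [Finsupp.smul_single, hk, Finsupp.single_zero]⟩
  have hus : ∀ k, ∀ e : E, p ^ k • e = 0 → ∃ x ∈ X, u x = e := by
    intro k
    induction k with
    | zero => intro e he; exact ⟨0, zero_mem _, by rw [map_zero]; simpa using he.symm⟩
    | succ k ih =>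
      intro e he
      let D : AddSubgroup E := (X.map (nsmulAddMonoidHom (p ^ k))).map u
      have hD : p ^ k • e ∈ D := by
        rw [← Finsupp.sum_single (p ^ k • e)]
        apply AddSubgroup.sum_mem
        intro i _
        have h1 : p • (p ^ k • e) i = 0 := by
          rw [← Finsupp.smul_apply, ← mul_smul, ← pow_succ', he]; rfl
        obtain ⟨z, hz⟩ := hsoc _ h1
        rw [hz]
        rw [← Finsupp.smul_single]
        apply AddSubgroup.zsmul_mem
        have hjk : k ≤ Nat.pair i k := Nat.right_le_pair i k
        refine ⟨b (Nat.pair i k), ⟨p ^ (Nat.pair i k - k) • y (Nat.pair i k), ?_, ?_⟩, ?_⟩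
        · exact X.nsmul_mem (AddSubgroup.subset_closure (Set.mem_range_self (Nat.pair i k))) _
        · show p ^ k • (p ^ (Nat.pair i k - k) • y (Nat.pair i k)) = _
          rw [← mul_smul, ← pow_add, Nat.add_sub_cancel' hjk, hy]
        · rw [hub, Nat.unpair_pair]
      obtain ⟨_, ⟨x, hx, rfl⟩, hxe⟩ := hD
      have hxe : u (p ^ k • x) = p ^ k • e := hxe
      obtain ⟨x', hx', h⟩ := ih (e - u x) (by rw [smul_sub, ← map_nsmul, hxe, sub_self])
      exact ⟨x' + x, X.add_mem hx' hx, by rw [map_add, h]; abel⟩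
  obtain ⟨v, hv1, hv2⟩ := exists_ne_surj hp hXt hdiv c hpc hc
  apply hv2
  refine keyA hG (finsupp_div hdiv) X.subtype Subtype.val_injective (u.comp X.subtype) v ?_ hv1
  intro e
  obtain ⟨k, hk⟩ := hEt e
  obtain ⟨x, hx, h⟩ := hus k e hk
  exact ⟨⟨x, hx⟩, h⟩

theorem tor_prime {G : Type*} [AddCommGroup G] (hG : IsCoBassian G) {p : ℕ} (hp : p.Prime) :
    Finite (nsmulAddMonoidHom p : G →+ G).ker := by
  classical
  by_contra hcon
  let S : ℕ → AddSubgroup G := fun n =>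
    (nsmulAddMonoidHom p : G →+ G).ker ⊓ (nsmulAddMonoidHom (p ^ n) : G →+ G).range
  have hS : ∀ n x, x ∈ S n ↔ p • x = 0 ∧ ∃ y, p ^ n • y = x := fun n x => Iff.rfl
  by_cases hall : ∀ n, Infinite (S n)
  · exact caseA hG hp S hS hall
  have hex : ∃ n, Finite (S n) := by
    push Not at hall
    obtain ⟨n, hn⟩ := hall
    exact ⟨n, by simpa using hn⟩
  have hm0 := Nat.find_spec hex
  have hmin := fun m => @Nat.find_min _ _ hex m
  generalize Nat.find hex = N at hm0 hmin
  cases N with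
  | zero =>
    apply hcon
    have : S 0 = (nsmulAddMonoidHom p : G →+ G).ker := by
      ext x
      rw [hS]
      constructor
      · exact fun h => h.1
      · exact fun h => ⟨h, x, by simp⟩
    rwa [this] at hm0
  | succ m =>
    have hi : Infinite (S m) := not_finite_iff_infinite.mp (hmin m (Nat.lt_succ_self m))
    obtain ⟨b, hbS, hb⟩ := selSeq hp (fun _ => S m) (fun _ => hi)
      (fun n x hx => ((hS m x).mp hx).1) (S (m + 1)) hm0
    choose x hx using fun j => ((hS m _).mp (hbS j)).2
    have hpb : ∀ j, p • b j = 0 := fun j => ((hS m _).mp (hbS j)).1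
    have hsum : ∀ a : ℕ →₀ ℤ, p ^ m • Finsupp.linearCombination ℤ x a = Finsupp.linearCombination ℤ b a := by
      intro a
      induction a using Finsupp.induction_linear with
      | zero => simp
      | add a a' h h' => rw [map_add, map_add, smul_add, h, h']
      | single j z => 
        rw [Finsupp.linearCombination_single, Finsupp.linearCombination_single, smul_comm, hx]
    have hsum0 : ∀ a : ℕ →₀ ℤ, p • Finsupp.linearCombination ℤ b a = 0 := by
      intro a
      induction a using Finsupp.induction_linear with
      | zero => simp
      | add a a' h h' => rw [map_add, smul_add, h, h', add_zero]
      | single j z => rw [Finsupp.linearCombination_single, smul_comm, hpb, smul_zero]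
    obtain ⟨i, r, hri, -⟩ := lemmaZ hp m x
      (fun j => by rw [pow_succ', mul_smul, hx, hpb]) (by
        intro a g h
        rw [hsum] at h
        exact hb a ((hS _ _).mpr ⟨hsum0 a, g, h.symm⟩))
    have hsurj := retr_surj hG i r hri (Finsupp.mapDomain.addMonoidHom Nat.succ)
      (Finsupp.mapDomain_injective Nat.succ_injective)
    obtain ⟨z, hz⟩ := hsurj (Finsupp.single 0 1)
    have h1 := DFunLike.congr_fun hz 0
    have h2 : (Finsupp.mapDomain Nat.succ z) 0 = 0 := by
      apply Finsupp.mapDomain_of_notMem_range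
      rintro ⟨i, hi⟩
      exact Nat.succ_ne_zero _ hi
    have h3 : (Finsupp.mapDomain.addMonoidHom Nat.succ z) 0 = (0 : ZMod (p ^ (m + 1))) := h2
    rw [h3, Finsupp.single_eq_same] at h1
    haveI : Fact (1 < p ^ (m + 1)) := ⟨Nat.one_lt_pow (by omega) hp.one_lt⟩
    exact zero_ne_one h1


theorem div_caseB {G : Type*} [AddCommGroup G] (hG : IsCoBassian G) {p : ℕ} (hp : p.Prime)
    (hall : ∀ x : G, p • x = 0 → ∀ n : ℕ, ∃ y, p ^ n • y = x) (g : G) :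
    ∃ (h t : G) (k : ℕ), g = p • h + t ∧ p ^ k • t = 0 := by
  let T : AddSubgroup G :=
    { carrier := {x | ∃ k : ℕ, p ^ k • x = 0}
      zero_mem' := ⟨0, by simp⟩
      add_mem' := by
        rintro a b ⟨m, h⟩ ⟨m', h'⟩
        refine ⟨m + m', ?_⟩
        rw [smul_add, pow_add, mul_smul _ _ b, h', mul_comm, mul_smul, h]; simp
      neg_mem' := by
        rintro a ⟨m, h⟩
        exact ⟨m, by rw [smul_neg, h, neg_zero]⟩ }
  have hT : ∀ x, x ∈ T ↔ ∃ k : ℕ, p ^ k • x = 0 := fun x => Iff.rfl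
  have hTp : ∀ k, ∀ x : G, p ^ k • x = 0 → ∃ y : G, p • y = x := by
    intro k
    induction k with
    | zero => intro x hx; exact ⟨0, by simpa using hx.symm⟩
    | succ k ih =>
      intro x hx
      obtain ⟨z, hz⟩ := hall (p ^ k • x) (by rwa [← mul_smul, ← pow_succ']) (k + 1)
      obtain ⟨y, hy⟩ := ih (x - p • z) (by rw [smul_sub, ← mul_smul, ← pow_succ, hz, sub_self])
      exact ⟨y + z, by rw [smul_add, hy]; abel⟩
  have hTp' : ∀ x : T, ∃ y : T, p • y = x := by
    rintro ⟨x, k, hk⟩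
    obtain ⟨y, hy⟩ := hTp k x hk
    exact ⟨⟨y, k + 1, by rw [pow_succ, mul_smul, hy, hk]⟩, Subtype.ext hy⟩
  have hTdiv : ∀ n : ℕ, 0 < n → ∀ d : T, ∃ x : T, n • x = d := by
    intro n
    induction n using induction_on_primes with
    | zero => intro h; exact absurd h (lt_irrefl _)
    | one => intro _ d; exact ⟨d, one_smul _ _⟩
    | prime_mul q a hq ih =>
      intro hn d
      have ha : 0 < a := Nat.pos_of_mul_pos_left hn
      have hqd : ∃ x : T, q • x = d := by
        by_cases hpq : q = p
        · subst hpq; exact hTp' d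
        obtain ⟨d, k, hk⟩ := d
        have hc : IsCoprime (q : ℤ) ((p ^ k : ℕ) : ℤ) := by
          rw [Nat.isCoprime_iff_coprime]
          exact Nat.Coprime.pow_right _ ((Nat.coprime_primes hq hp).mpr hpq)
        obtain ⟨u, v, huv⟩ := hc
        refine ⟨u • ⟨d, k, hk⟩, Subtype.ext ?_⟩
        show q • (u • d) = d
        have : d = (u * q + v * ((p ^ k : ℕ) : ℤ)) • d := by rw [huv, one_smul]
        rw [add_smul, mul_smul v, natCast_zsmul, hk, smul_zero, add_zero, mul_smul,
          natCast_zsmul, smul_comm] at this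
        exact this.symm
      obtain ⟨x, hx⟩ := hqd
      obtain ⟨y, hy⟩ := ih ha x
      exact ⟨y, by rw [mul_smul, hy, hx]⟩
  obtain ⟨r, hr⟩ := ext_of_div hTdiv T.subtype Subtype.val_injective (AddMonoidHom.id T)
  have hr : ∀ x : T, r (x : G) = x := hr
  let φ : G →+ G := T.subtype.comp r + p • (AddMonoidHom.id G - T.subtype.comp r)
  have hφ : ∀ g, φ g = (r g : G) + p • (g - (r g : G)) := fun g => rfl
  have hrφ : ∀ g, r (φ g) = r g := by
    intro g
    rw [hφ, map_add, map_nsmul, map_sub, hr, sub_self, smul_zero, add_zero]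
  obtain ⟨h, hh⟩ := crit hG (AddMonoidHom.id G) φ Function.surjective_id (by
    rw [injective_iff_map_eq_zero]
    intro x hx
    have h1 : r x = 0 := by rw [← hrφ, hx, map_zero]
    rw [hφ, h1] at hx
    have h2 : p • x = 0 := by simpa using hx
    have h3 := hr ⟨x, 1, by rwa [pow_one]⟩
    have h4 : r x = ⟨x, 1, by rwa [pow_one]⟩ := h3
    rw [h1] at h4
    exact (congrArg Subtype.val h4).symm) g
  obtain ⟨k, hk⟩ := (r h).2
  exact ⟨h - r h, r h, k, by rw [← hh, hφ, add_comm], hk⟩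

theorem div_prime_aux {p : ℕ} (hp : p.Prime) (m : ℕ) : ∀ (G : Type*) [AddCommGroup G],
    IsCoBassian G → Nat.card (nsmulAddMonoidHom p : G →+ G).ker = m → ∀ g : G,
    ∃ (h t : G) (k : ℕ), g = p • h + t ∧ p ^ k • t = 0 := by
  classical
  induction m using Nat.strong_induction_on with
  | _ m ih =>
  intro G _ hG hm g
  by_cases hall : ∀ x : G, p • x = 0 → ∀ n : ℕ, ∃ y, p ^ n • y = x
  · exact div_caseB hG hp hall g
  push Not at hall
  obtain ⟨x, hpx, hex⟩ := hall
  have hex : ∃ n : ℕ, ∀ y, p ^ n • y ≠ x := hex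
  have hN := Nat.find_spec hex
  have hmin := fun m => @Nat.find_min _ _ hex m
  generalize Nat.find hex = N at hN hmin
  cases N with
  | zero => exact absurd (by simp) (hN x)
  | succ n =>
  have := hmin n (Nat.lt_succ_self n)
  push Not at this
  obtain ⟨y, hy⟩ := this
  have hxC : x ∉ (nsmulAddMonoidHom (p ^ (n + 1)) : G →+ G).range := by
    rintro ⟨w, hw⟩
    exact hN w hw
  have hx0 : x ≠ 0 := by
    rintro rfl
    exact hxC (zero_mem _)
  obtain ⟨i, r, hri, hi⟩ := lemmaZ hp n (fun _ : Unit => y)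
    (fun _ => by rw [pow_succ', mul_smul, hy, hpx]) (by
      intro a w haw j
      by_contra hnd
      apply hxC
      apply cop_mem hp hnd
      · rw [natCast_zsmul, hpx]; exact zero_mem _
      · refine ⟨w, ?_⟩
        show p ^ (n + 1) • w = a j • x
        rw [← haw, ← hy, Finsupp.linearCombination_apply, Finsupp.sum_fintype _ _ (by simp)]
        simp only [Finset.univ_unique, Finset.sum_singleton]
        rw [smul_comm])
  have hxi : ∃ z, i z = x := by
    refine ⟨p ^ n • Finsupp.mapRange.addMonoidHom (Int.castAddHom (ZMod (p ^ (n + 1))))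
      (Finsupp.single () 1), ?_⟩
    rw [map_nsmul, hi, Finsupp.linearCombination_single, one_smul, hy]
  obtain ⟨z, hz⟩ := hxi
  have hrx : r x ≠ 0 := by
    intro h
    rw [← hz, hri] at h
    rw [h, map_zero] at hz
    exact hx0 hz.symm
  have hfin := tor_prime hG hp
  have hlt : Nat.card (nsmulAddMonoidHom p : r.ker →+ r.ker).ker < m := by
    rw [← hm]
    have hfin' : Finite ((nsmulAddMonoidHom p : G →+ G).ker ⊓ r.ker : AddSubgroup G) :=
      Finite.of_injective _ (AddSubgroup.inclusion_injective inf_le_left)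
    let f : (nsmulAddMonoidHom p : r.ker →+ r.ker).ker → (nsmulAddMonoidHom p : G →+ G).ker :=
      fun w => ⟨w.1.1, congrArg Subtype.val w.2⟩
    have hf : Function.Injective f := by
      intro a b hab
      have hv : (a.1.1 : G) = b.1.1 := congrArg (fun w => (w.1 : G)) hab
      exact Subtype.ext (Subtype.ext hv)
    refine lt_of_le_of_ne (Nat.card_le_card_of_injective f hf) ?_
    intro heq
    have hb := (Nat.bijective_iff_injective_and_card f).mpr ⟨hf, heq⟩
    obtain ⟨w, hw⟩ := hb.2 ⟨x, hpx⟩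
    have hw : (w.1.1 : G) = x := congrArg Subtype.val hw
    apply hrx
    rw [← hw]
    exact w.1.2
  have hgk : g - i (r g) ∈ r.ker := by
    rw [AddMonoidHom.mem_ker, map_sub, hri, sub_self]
  obtain ⟨h, t, k, hht, hk⟩ := ih _ hlt r.ker (retr_ker hG i r hri) rfl ⟨_, hgk⟩
  have h1 : g - i (r g) = p • (h : G) + t := congrArg Subtype.val hht
  have h2 : p ^ k • (t : G) = 0 := congrArg Subtype.val hk
  have h3 : p ^ (n + 1) • i (r g) = 0 := by
    rw [← map_nsmul]
    have : p ^ (n + 1) • r g = 0 := by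
      ext j
      rw [Finsupp.smul_apply, nsmul_eq_mul, ZMod.natCast_self, zero_mul]; rfl
    rw [this, map_zero]
  refine ⟨h, t + i (r g), k + (n + 1), ?_, ?_⟩
  · rw [← add_assoc, ← h1]; abel
  · rw [smul_add, pow_add, mul_smul _ _ (i (r g)), h3, mul_comm, mul_smul, h2]; simp

theorem cob_good {G : Type*} [AddCommGroup G] (hG : IsCoBassian G) : Good G := by
  refine ⟨rank_fin hG, ?_, ?_⟩
  · intro n
    induction n using induction_on_primes with
    | zero => intro h; exact absurd h (lt_irrefl _)
    | one =>
      intro _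
      have : Subsingleton (nsmulAddMonoidHom 1 : G →+ G).ker := by
        constructor
        rintro ⟨a, ha⟩ ⟨b, hb⟩
        have ha : 1 • a = 0 := ha
        have hb : 1 • b = 0 := hb
        rw [one_smul] at ha hb
        exact Subtype.ext (ha.trans hb.symm)
      infer_instance
    | prime_mul q a hq ih =>
      intro hn
      have ha : 0 < a := Nat.pos_of_mul_pos_left hn
      have h1 := ih ha
      have h2 := tor_prime hG hq
      let f : (nsmulAddMonoidHom (q * a) : G →+ G).ker →+ (nsmulAddMonoidHom q : G →+ G).ker :=
        ((nsmulAddMonoidHom a).comp (AddSubgroup.subtype _)).codRestrict _ (by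
          intro x
          show q • (a • (x : G)) = 0
          rw [← mul_smul]
          exact x.2)
      have hk : Finite f.ker := by
        let e : f.ker → (nsmulAddMonoidHom a : G →+ G).ker :=
          fun w => ⟨w.1.1, congrArg Subtype.val w.2⟩
        refine Finite.of_injective e ?_
        intro a b hab
        have hv : (a.1.1 : G) = b.1.1 := congrArg (fun w => (w.1 : G)) hab
        exact Subtype.ext (Subtype.ext hv)
      have hr : Finite f.range := inferInstance
      have hq' : Finite ((nsmulAddMonoidHom (q * a) : G →+ G).ker ⧸ f.ker) :=
        Finite.of_equiv _ (QuotientAddGroup.quotientKerEquivRange f).symm.toEquiv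
      exact Finite.of_equiv _ (AddSubgroup.addGroupEquivQuotientProdAddSubgroup (s := f.ker)).symm
  · intro n
    induction n using induction_on_primes with
    | zero => intro h; exact absurd h (lt_irrefl _)
    | one => intro _ g; exact ⟨g, 0, by simp, 1, one_pos, smul_zero _⟩
    | prime_mul q a hq ih =>
      intro hn g
      have ha : 0 < a := Nat.pos_of_mul_pos_left hn
      obtain ⟨h, t, k, hg, hk⟩ := div_prime_aux hq _ G hG rfl g
      obtain ⟨h', t', hh, m, hm, hmt⟩ := ih ha h
      refine ⟨h', q • t' + t, ?_, q ^ k * m, Nat.mul_pos (pow_pos hq.pos k) hm, ?_⟩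
      · rw [hg, hh, smul_add, mul_smul, add_assoc]
      · rw [smul_add, mul_smul _ _ (q • t'), smul_comm m q t', hmt, mul_comm, mul_smul, hk]
        simp

end CoB

/-- a group is super co-Bassian iff it is co-Bassian. -/
theorem superCoBassian_iff_coBassian (G : Type*) [AddCommGroup G] :
    (∀ K : AddSubgroup G, IsCoBassian (G ⧸ K)) ↔ IsCoBassian G := by
  constructor
  · intro h N φ hφ
    let e : G ⧸ (⊥ : AddSubgroup G) ≃+ G := QuotientAddGroup.quotientBot
    have := CoB.crit (h ⊥) ((QuotientAddGroup.mk' N).comp e.toAddMonoidHom)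
      (φ.comp e.toAddMonoidHom) ((QuotientAddGroup.mk'_surjective N).comp e.surjective)
      (hφ.comp e.injective)
    intro y
    obtain ⟨x, hx⟩ := this y
    exact ⟨e x, hx⟩
  · exact fun h K => CoB.good_cob (CoB.good_quot (CoB.cob_good h) K)
end
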